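/- For every totally positive ν ∈ O_K, r_{2,K}(ν) = 2·σ_{0,χ}(ν) + 2·σ_{0,ρ₂}^{ρ₂'}(ν). -/

import Mathlib

/-!
Statements about sums of squares in K = ℚ(√17), with ring of integers
O_K = ℤ[ω], ω = (1+√17)/2, realized as ℤ[X]/(X² − X − 4).
-/

noncomputable section

namespace Paper17

open Polynomial

/-- The ring of integers ℤ[ω] of ℚ(√17), ω = (1+√17)/2, as ℤ[X]/(X² − X − 4). -/
abbrev O17 : Type := AdjoinRoot (X ^ 2 - X - C 4 : ℤ[X])

/-- ω = (1+√17)/2 as an element of O17. -/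
def ω : O17 := AdjoinRoot.root _

lemma hroot : (X ^ 2 - X - C 4 : ℤ[X]).eval₂ (Int.castRingHom ℝ)
    ((1 + Real.sqrt 17) / 2) = 0 := by
  have h : Real.sqrt 17 ^ 2 = 17 := Real.sq_sqrt (by norm_num)
  simp only [eval₂_sub, eval₂_pow, eval₂_X, eval₂_C, eval₂_ofNat, map_ofNat]
  nlinarith [h]

lemma hroot' : (X ^ 2 - X - C 4 : ℤ[X]).eval₂ (Int.castRingHom ℝ)
    ((1 - Real.sqrt 17) / 2) = 0 := by
  have h : Real.sqrt 17 ^ 2 = 17 := Real.sq_sqrt (by norm_num)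
  simp only [eval₂_sub, eval₂_pow, eval₂_X, eval₂_C, eval₂_ofNat, map_ofNat]
  nlinarith [h]

/-- The real embedding sending ω to (1+√17)/2. -/
def emb1 : O17 →+* ℝ := AdjoinRoot.lift (Int.castRingHom ℝ) ((1 + Real.sqrt 17) / 2) hroot

/-- The real embedding sending ω to (1−√17)/2. -/
def emb2 : O17 →+* ℝ := AdjoinRoot.lift (Int.castRingHom ℝ) ((1 - Real.sqrt 17) / 2) hroot'

/-- An element of O_K is totally positive if its images under both real embeddings
are positive. -/
def TotPos (x : O17) : Prop := 0 < emb1 x ∧ 0 < emb2 x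

/-- π₂ = (5+√17)/2 = 2 + ω. -/
def pi2 : O17 := 2 + ω

/-- π₂' = (5−√17)/2 = 3 − ω. -/
def pi2' : O17 := 3 - ω

/-- `r2 ν` is the number of pairs (x₁,x₂) ∈ O_K² with x₁² + x₂² = ν. -/
def r2 (ν : O17) : ℕ :=
  Set.ncard {t : O17 × O17 | t.1 ^ 2 + t.2 ^ 2 = ν}

/-- The nontrivial Dirichlet character mod 4 (with ℤ-values). -/
def chim4 (n : ℤ) : ℤ := if n % 4 = 1 then 1 else if n % 4 = 3 then -1 else 0

/-- The element a + bω of O_K. -/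
def elt (a b : ℤ) : O17 := (a : O17) + (b : O17) * ω

open Classical in
/-- Given g : ℤ → ℤ → ℤ, the function on nonzero ideals 𝔞 of O_K sending 𝔞 with
totally positive generator a + bω to χ₋₄(g a b) (well defined for the g below,
since the totally positive generator is unique up to even powers of ε₀ and
ε₀² ≡ 1 (mod 4)). -/
def idealChar (g : ℤ → ℤ → ℤ) (I : Ideal O17) : ℤ :=
  if h : ∃ a b : ℤ, I = Ideal.span {elt a b} ∧ TotPos (elt a b) then
    chim4 (g h.choose h.choose_spec.choose)
  else 0

/-- χ(𝔞) = χ₋₄(N_{K/ℚ}(μ)) for a totally positive generator μ = a + bω of 𝔞;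
here N_{K/ℚ}(a + bω) = a² + ab − 4b². -/
def chi : Ideal O17 → ℤ := idealChar fun a b => a ^ 2 + a * b - 4 * b ^ 2

/-- ρ₂(𝔞) = χ₋₄(a) for a totally positive generator a + bω of 𝔞. -/
def rho : Ideal O17 → ℤ := idealChar fun a _ => a

/-- ρ₂'(𝔞) = χ₋₄(a + b) for a totally positive generator a + bω of 𝔞. -/
def rho' : Ideal O17 → ℤ := idealChar fun a b => a + b

/-- σ_{0,χ}(ν) = Σ_{𝔞 ∣ (ν)} χ(𝔞). -/
def sigmaChi (ν : O17) : ℤ :=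
  ∑ᶠ I ∈ {I : Ideal O17 | I ∣ Ideal.span {ν}}, chi I

/-- σ_{0,ρ₂}^{ρ₂'}(ν) = Σ_{𝔞 ∣ (ν)} ρ₂(𝔞)·ρ₂'((ν)𝔞⁻¹), i.e. the sum of ρ₂(𝔞)·ρ₂'(𝔟)
over all factorizations (ν) = 𝔞·𝔟. -/
def sigmaRho (ν : O17) : ℤ :=
  ∑ᶠ p ∈ {p : Ideal O17 × Ideal O17 | p.1 * p.2 = Ideal.span {ν}},
    rho p.1 * rho' p.2

lemma omega_sq : ω ^ 2 = ω + 4 := by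
  have h : AdjoinRoot.mk (X ^ 2 - X - C 4 : ℤ[X]) (X ^ 2 - X - C 4) = 0 := AdjoinRoot.mk_self
  simp only [map_sub, map_pow, AdjoinRoot.mk_X, AdjoinRoot.mk_C] at h
  have h4 : AdjoinRoot.of (X ^ 2 - X - C 4 : ℤ[X]) 4 = 4 := map_ofNat _ 4
  rw [h4] at h
  unfold ω
  linear_combination h

lemma elt_add (a b c d : ℤ) : elt a b + elt c d = elt (a + c) (b + d) := by
  simp only [elt]; push_cast; ring

lemma elt_sub (a b c d : ℤ) : elt a b - elt c d = elt (a - c) (b - d) := by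
  simp only [elt]; push_cast; ring

lemma elt_mul (a b c d : ℤ) :
    elt a b * elt c d = elt (a * c + 4 * b * d) (a * d + b * c + b * d) := by
  simp only [elt]; push_cast; linear_combination (b * d : O17) * omega_sq

lemma elt_sq (a b : ℤ) : elt a b ^ 2 = elt (a ^ 2 + 4 * b ^ 2) (2 * a * b + b ^ 2) := by
  rw [pow_two, elt_mul]; congr 1 <;> ring

lemma intCast_eq_elt (a : ℤ) : (a : O17) = elt a 0 := by simp [elt]

lemma one_eq_elt : (1 : O17) = elt 1 0 := by simp [elt]

lemma zero_eq_elt : (0 : O17) = elt 0 0 := by simp [elt]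

lemma pi2_eq_elt : pi2 = elt 2 1 := by simp [elt, pi2]

lemma pi2'_eq_elt : pi2' = elt 3 (-1) := by simp [elt, pi2', sub_eq_add_neg]

lemma two_eq_elt : (2 : O17) = elt 2 0 := by simp [elt]

lemma pi2_mul_pi2' : pi2 * pi2' = 2 := by
  rw [pi2_eq_elt, pi2'_eq_elt, elt_mul, two_eq_elt]; norm_num

lemma exists_elt (x : O17) : ∃ a b : ℤ, x = elt a b := by
  induction x using AdjoinRoot.induction_on with
  | ih p =>
    induction p using Polynomial.induction_on with
    | C a => exact ⟨a, 0, by simp [elt]⟩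
    | add p q hp hq =>
      obtain ⟨a, b, h⟩ := hp
      obtain ⟨c, d, h'⟩ := hq
      exact ⟨a + c, b + d, by rw [map_add, h, h', elt_add]⟩
    | monomial n a h =>
      obtain ⟨c, d, h⟩ := h
      refine ⟨4 * d, c + d, ?_⟩
      have e : ω = elt 0 1 := by simp [elt]
      have : AdjoinRoot.mk (X ^ 2 - X - C 4 : ℤ[X]) (C a * X ^ (n + 1)) = elt c d * ω := by
        rw [← h, pow_succ X n, ← mul_assoc, map_mul _ _ X, AdjoinRoot.mk_X]; rfl
      rw [this, e, elt_mul]; congr 1 <;> ring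

lemma emb1_elt (a b : ℤ) : emb1 (elt a b) = a + b * ((1 + Real.sqrt 17) / 2) := by
  simp [emb1, elt, ω]

lemma emb2_elt (a b : ℤ) : emb2 (elt a b) = a + b * ((1 - Real.sqrt 17) / 2) := by
  simp [emb2, elt, ω]

/-- Ring homomorphisms out of `O17` are given by roots of `X² - X - 4`. -/
def homOfRoot {S : Type*} [CommRing S] (s : S) (hs : s ^ 2 - s - 4 = 0) : O17 →+* S :=
  AdjoinRoot.lift (Int.castRingHom S) s (by simpa using hs)

lemma homOfRoot_elt {S : Type*} [CommRing S] (s : S) (hs : s ^ 2 - s - 4 = 0) (a b : ℤ) :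
    homOfRoot s hs (elt a b) = a + b * s := by
  simp [homOfRoot, elt, ω]

lemma sqrt17_sq : Real.sqrt 17 ^ 2 = 17 := Real.sq_sqrt (by norm_num)

lemma irrational_sqrt17 : Irrational (Real.sqrt 17) := by
  have := Nat.Prime.irrational_sqrt (p := 17) (by norm_num)
  simpa using this

lemma sq_eq_17_mul_sq {s b : ℤ} (h : s ^ 2 = 17 * b ^ 2) : s = 0 ∧ b = 0 := by
  have hb : b = 0 := by
    by_contra hb
    apply irrational_sqrt17
    refine ⟨|(s : ℚ) / b|, ?_⟩
    have hb' : (b : ℝ) ≠ 0 := by exact_mod_cast hb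
    have h' : (s : ℝ) ^ 2 = 17 * b ^ 2 := by exact_mod_cast h
    rw [eq_comm, Real.sqrt_eq_iff_mul_self_eq (by norm_num) (by positivity)]
    push_cast
    rw [← sq, sq_abs, div_pow, h']
    field_simp
  subst hb
  exact ⟨by simpa using h, rfl⟩

lemma emb1_injective : Function.Injective emb1 := by
  rw [injective_iff_map_eq_zero]
  intro x hx
  obtain ⟨a, b, rfl⟩ := exists_elt x
  rw [emb1_elt] at hx
  have h : ((2 * a + b : ℤ) : ℝ) ^ 2 = 17 * b ^ 2 := by
    push_cast
    linear_combination (2 * (2 * a + b - b * Real.sqrt 17)) * hx + b ^ 2 * sqrt17_sq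
  obtain ⟨h1, h2⟩ := sq_eq_17_mul_sq (by exact_mod_cast h)
  rw [zero_eq_elt]; congr 1; omega

instance : IsDomain O17 := emb1_injective.isDomain emb1

instance : CharZero O17 :=
  ⟨fun m n h => by have := congrArg emb1 h; simpa using this⟩

lemma elt_inj {a b c d : ℤ} (h : elt a b = elt c d) : a = c ∧ b = d := by
  have h1 : elt (a - c) (b - d) = 0 := by rw [← elt_sub, h, sub_self]
  have e1 := congrArg emb1 h1
  have e2 := congrArg emb2 h1
  rw [emb1_elt, map_zero] at e1
  rw [emb2_elt, map_zero] at e2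
  have e3 : ((b - d : ℤ) : ℝ) * Real.sqrt 17 = 0 := by linear_combination e1 - e2
  have e4 : ((b - d : ℤ) : ℝ) = 0 := by
    rcases mul_eq_zero.1 e3 with h | h
    · exact h
    · exact absurd h (by positivity)
  rw [e4] at e1
  have e5 : ((a - c : ℤ) : ℝ) = 0 := by linear_combination e1
  norm_cast at e4 e5
  omega

/-- The identification of `O17` with Mathlib's quadratic algebra. -/
def toQuad : O17 →+* QuadraticAlgebra ℤ 4 1 :=
  homOfRoot ⟨0, 1⟩ (by ext <;> simp [pow_two] <;> rfl)

/-- The norm of `O17` over `ℤ`. -/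
def nrm (x : O17) : ℤ := QuadraticAlgebra.norm (toQuad x)

lemma nrm_elt (a b : ℤ) : nrm (elt a b) = a ^ 2 + a * b - 4 * b ^ 2 := by
  simp [nrm, toQuad, homOfRoot_elt, QuadraticAlgebra.norm_def]
  ring

lemma nrm_mul (x y : O17) : nrm (x * y) = nrm x * nrm y := by simp [nrm]

lemma nrm_one : nrm 1 = 1 := by simp [nrm]

lemma nrm_zero : nrm 0 = 0 := by simp [nrm]

lemma nrm_intCast (n : ℤ) : nrm n = n ^ 2 := by simp [nrm]

lemma nrm_eq_emb (x : O17) : (nrm x : ℝ) = emb1 x * emb2 x := by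
  obtain ⟨a, b, rfl⟩ := exists_elt x
  rw [nrm_elt, emb1_elt, emb2_elt]; push_cast
  linear_combination (b ^ 2 / 4 : ℝ) * sqrt17_sq

/-- The trace of `O17` over `ℤ`. -/
def trc (x : O17) : ℤ := QuadraticAlgebra.trace (toQuad x)

lemma trc_elt (a b : ℤ) : trc (elt a b) = 2 * a + b := by
  simp [trc, toQuad, homOfRoot_elt, QuadraticAlgebra.trace_def]

lemma trc_eq_emb (x : O17) : (trc x : ℝ) = emb1 x + emb2 x := by
  obtain ⟨a, b, rfl⟩ := exists_elt x
  rw [trc_elt, emb1_elt, emb2_elt]; push_cast; ring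

lemma emb2_injective : Function.Injective emb2 := by
  rw [injective_iff_map_eq_zero]
  intro x hx
  apply emb1_injective
  obtain ⟨a, b, rfl⟩ := exists_elt x
  rw [emb2_elt] at hx
  have h : ((2 * a + b : ℤ) : ℝ) ^ 2 = 17 * b ^ 2 := by
    push_cast
    linear_combination (2 * (2 * a + b + b * Real.sqrt 17)) * hx + b ^ 2 * sqrt17_sq
  obtain ⟨h1, h2⟩ := sq_eq_17_mul_sq (by exact_mod_cast h)
  obtain rfl : a = 0 := by omega
  rw [h2, ← zero_eq_elt]

lemma nrm_eq_zero {x : O17} : nrm x = 0 ↔ x = 0 := by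
  refine ⟨fun h => ?_, fun h => h ▸ nrm_zero⟩
  have h' := nrm_eq_emb x
  rw [h, Int.cast_zero, eq_comm, mul_eq_zero] at h'
  rcases h' with h' | h'
  · exact emb1_injective (by rw [h', map_zero])
  · exact emb2_injective (by rw [h', map_zero])

/-- Every element divides its norm, the cofactor being its conjugate. -/
lemma exists_conj (x : O17) : ∃ y, x * y = nrm x := by
  obtain ⟨a, b, rfl⟩ := exists_elt x
  refine ⟨elt (a + b) (-b), ?_⟩
  rw [elt_mul, nrm_elt, intCast_eq_elt]; congr 1 <;> ring

lemma isUnit_iff_nrm {x : O17} : IsUnit x ↔ IsUnit (nrm x) := by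
  constructor
  · rintro ⟨u, rfl⟩
    exact IsUnit.of_mul_eq_one (nrm (↑u⁻¹ : O17)) (by rw [← nrm_mul]; simp [nrm_one])
  · intro h
    obtain ⟨y, hy⟩ := exists_conj x
    have : IsUnit (x * y) := by rw [hy]; exact h.map (Int.castRingHom O17)
    exact isUnit_of_mul_isUnit_left this

lemma exists_euclid (x y : O17) (hy : y ≠ 0) : ∃ q, |nrm (x - y * q)| < |nrm y| := by
  obtain ⟨y', hy'⟩ := exists_conj y
  have hn : nrm y ≠ 0 := fun h => hy (nrm_eq_zero.1 h)
  have hy0 : nrm y' ≠ 0 := by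
    intro h
    have := congrArg nrm hy'
    rw [nrm_mul, h, mul_zero, nrm_intCast] at this
    exact hn (pow_eq_zero_iff (two_ne_zero) |>.1 this.symm)
  obtain ⟨a, b, hab⟩ := exists_elt (x * y')
  generalize hN : nrm y = N at *
  have key : ∃ c d : ℤ, |nrm (elt (a - N * c) (b - N * d))| < N ^ 2 := by
    have hNR : (N : ℝ) ≠ 0 := by exact_mod_cast hn
    set β : ℝ := b / N with hβ
    set α : ℝ := a / N with hα
    set d : ℤ := round β with hd
    have hδ : |β - d| ≤ 1 / 2 := abs_sub_round β
    set δ := β - d with hδ'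
    have main : ∃ c : ℤ, |(2 * (α - c) + δ) ^ 2 - 17 * δ ^ 2| < 4 := by
      set c0 := round (α + δ / 2) with hc0
      have hc : |α + δ / 2 - c0| ≤ 1 / 2 := abs_sub_round _
      rw [abs_le] at hc hδ
      by_cases h17 : 17 * δ ^ 2 < 4
      · refine ⟨c0, ?_⟩
        rw [abs_lt]
        constructor <;> nlinarith
      · rcases le_total 0 (α + δ / 2 - c0) with h0 | h0
        · refine ⟨c0 + 1, ?_⟩
          rw [abs_lt]; push_cast
          constructor <;> nlinarith
        · refine ⟨c0 - 1, ?_⟩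
          rw [abs_lt]; push_cast
          constructor <;> nlinarith
    obtain ⟨c, hc⟩ := main
    refine ⟨c, d, ?_⟩
    rw [nrm_elt]
    have ea : (a : ℝ) = N * α := by rw [hα]; field_simp
    have eb : (b : ℝ) = N * (δ + d) := by rw [hδ', hβ]; field_simp; ring
    have h4 : |((a - N * c : ℤ) ^ 2 + (a - N * c : ℤ) * (b - N * d : ℤ)
        - 4 * (b - N * d : ℤ) ^ 2 : ℝ)| < N ^ 2 := by
      push_cast
      rw [ea, eb]
      have : ((N * α - N * c) ^ 2 + (N * α - N * c) * (N * (δ + d) - N * d)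
        - 4 * (N * (δ + d) - N * d) ^ 2 : ℝ) = N ^ 2 / 4 * ((2 * (α - c) + δ) ^ 2 - 17 * δ ^ 2) := by
        ring
      rw [this, abs_mul, abs_of_pos (by positivity)]
      have : (0 : ℝ) < N ^ 2 / 4 := by positivity
      nlinarith
    exact_mod_cast h4
  obtain ⟨c, d, h⟩ := key
  refine ⟨elt c d, ?_⟩
  have e : elt (a - N * c) (b - N * d) = (x - y * elt c d) * y' := by
    rw [sub_mul, hab, mul_right_comm, hy', intCast_eq_elt, elt_mul, elt_sub]
    congr 1 <;> ring
  rw [e, nrm_mul, abs_mul] at h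
  have e2 : |N| * |nrm y'| = N ^ 2 := by
    have := congrArg nrm hy'
    rw [nrm_mul, hN, nrm_intCast] at this
    rw [← abs_mul, this, abs_of_nonneg (sq_nonneg N)]
  rw [← e2] at h
  exact lt_of_mul_lt_mul_right h (abs_nonneg _)

instance : IsPrincipalIdealRing O17 := by
  have hE : ∀ x y : O17, ∃ q, y ≠ 0 → |nrm (x - y * q)| < |nrm y| := fun x y => by
    by_cases hy : y = 0
    · exact ⟨0, fun h => absurd hy h⟩
    · obtain ⟨q, hq⟩ := exists_euclid x y hy
      exact ⟨q, fun _ => hq⟩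
  choose q hq using hE
  classical
  let _ : EuclideanDomain O17 :=
    { (inferInstance : CommRing O17), (inferInstance : Nontrivial O17) with
      quotient := fun x y => if y = 0 then 0 else q x y
      quotient_zero := by simp
      remainder := fun x y => if y = 0 then x else x - y * q x y
      quotient_mul_add_remainder_eq := by
        intro a b
        by_cases h : b = 0 <;> simp [h]
      r := fun x y => (nrm x).natAbs < (nrm y).natAbs
      r_wellFounded := (measure fun x : O17 => (nrm x).natAbs).wf
      remainder_lt := by
        intro a b h
        have := hq a b h
        simp only [h, if_false]
        zify
        exact this
      mul_left_not_lt := by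
        intro a b h
        have : 1 ≤ (nrm b).natAbs := by
          have := mt nrm_eq_zero.1 h
          omega
        rw [nrm_mul, Int.natAbs_mul, not_lt]
        exact Nat.le_mul_of_pos_right _ this }
  exact EuclideanDomain.to_principal_ideal_domain

lemma TotPos.mul {x y : O17} (hx : TotPos x) (hy : TotPos y) : TotPos (x * y) := by
  simp only [TotPos, map_mul]
  exact ⟨mul_pos hx.1 hy.1, mul_pos hx.2 hy.2⟩

lemma TotPos.of_mul {x y : O17} (hxy : TotPos (x * y)) (hx : TotPos x) : TotPos y := by
  simp only [TotPos, map_mul] at hxy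
  exact ⟨(pos_iff_pos_of_mul_pos hxy.1).1 hx.1, (pos_iff_pos_of_mul_pos hxy.2).1 hx.2⟩

lemma TotPos.ne_zero {x : O17} (hx : TotPos x) : x ≠ 0 := by
  rintro rfl
  simp [TotPos] at hx

lemma TotPos.nrm_pos {x : O17} (hx : TotPos x) : 0 < nrm x := by
  have := mul_pos hx.1 hx.2
  rw [← nrm_eq_emb] at this
  exact_mod_cast this

lemma TotPos.trc_pos {x : O17} (hx : TotPos x) : 0 < trc x := by
  have := add_pos hx.1 hx.2
  rw [← trc_eq_emb] at this
  exact_mod_cast this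

lemma totPos_of_nrm_trc {x : O17} (hn : 0 < nrm x) (ht : 0 < trc x) : TotPos x := by
  have hn' : (0 : ℝ) < emb1 x * emb2 x := by rw [← nrm_eq_emb]; exact_mod_cast hn
  have ht' : (0 : ℝ) < emb1 x + emb2 x := by rw [← trc_eq_emb]; exact_mod_cast ht
  rcases mul_pos_iff.1 hn' with h | h
  · exact h
  · linarith

lemma totPos_one : TotPos 1 := by simp [TotPos]

lemma totPos_pi2 : TotPos pi2 := by
  rw [pi2_eq_elt]; apply totPos_of_nrm_trc <;> simp [nrm_elt, trc_elt]

lemma totPos_pi2' : TotPos pi2' := by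
  rw [pi2'_eq_elt]; apply totPos_of_nrm_trc <;> simp [nrm_elt, trc_elt]

lemma totPos_sq {x : O17} (hx : x ≠ 0) : TotPos (x ^ 2) := by
  have h1 : emb1 x ≠ 0 := fun h => hx (emb1_injective (by rw [h, map_zero]))
  have h2 : emb2 x ≠ 0 := fun h => hx (emb2_injective (by rw [h, map_zero]))
  simp only [TotPos, map_pow]
  exact ⟨by positivity, by positivity⟩

lemma totPos_sq_add_sq {x y : O17} (h : x ≠ 0 ∨ y ≠ 0) : TotPos (x ^ 2 + y ^ 2) := by
  have key : ∀ {x y : O17}, x ≠ 0 → TotPos (x ^ 2 + y ^ 2) := by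
    intro x y hx
    have := totPos_sq hx
    simp only [TotPos, map_add, map_pow] at this ⊢
    exact ⟨by nlinarith [sq_nonneg (emb1 y)], by nlinarith [sq_nonneg (emb2 y)]⟩
  rcases h with h | h
  · exact key h
  · rw [add_comm]; exact key h

lemma sq_of_nrm_eq_one_of_nonneg (n : ℕ) : ∀ a b : ℤ, 0 ≤ b → b.toNat ≤ n → 0 < 2 * a + b →
    nrm (elt a b) = 1 → ∃ v, elt a b = v ^ 2 := by
  induction n with
  | zero =>
    intro a b hb hn hp h
    obtain rfl : b = 0 := by omega
    rw [nrm_elt] at h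
    obtain rfl : a = 1 := by nlinarith
    exact ⟨1, by rw [one_pow, one_eq_elt]⟩
  | succ n ih =>
    intro a b hb hn hp h
    rcases Nat.eq_zero_or_pos b.toNat with h0 | h0
    · exact ih a b hb (by omega) hp h
    have hbeven : ∃ B, b = 2 * B := by
      rcases Int.even_or_odd' b with ⟨B, hB | hB⟩
      · exact ⟨B, hB⟩
      · exfalso
        rw [nrm_elt] at h
        rcases Int.even_or_odd' a with ⟨A, hA | hA⟩ <;> subst hA hB <;> ring_nf at h <;> omega
    obtain ⟨B, rfl⟩ := hbeven
    have hB : 0 < B := by omega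
    have e : (a + B) ^ 2 - 17 * B ^ 2 = 1 := by rw [nrm_elt] at h; linarith
    obtain ⟨t, rfl⟩ : ∃ t, a = t - B := ⟨a + B, by ring⟩
    rw [sub_add_cancel] at e
    have ht : 0 < t := by omega
    have h4 : 4 * B < t := by nlinarith
    have hB8 : 8 ≤ B := by
      by_contra hlt
      push Not at hlt
      have : t < 5 * B := by nlinarith
      interval_cases B <;> first | omega | (interval_cases t <;> omega)
    have h8 : 8 * t ≤ 33 * B := by nlinarith
    have e1 : elt (t - B) (2 * B) * elt 41 (-16) =
        elt (41 * (t - B) - 64 * (2 * B)) (25 * (2 * B) - 16 * (t - B)) := by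
      rw [elt_mul]; congr 1 <;> ring
    have e2 : elt 41 (-16) * elt 3 2 ^ 2 = 1 := by
      rw [elt_sq, elt_mul, one_eq_elt]; norm_num
    obtain ⟨v, hv⟩ := ih (41 * (t - B) - 64 * (2 * B)) (25 * (2 * B) - 16 * (t - B))
      (by linarith) (by omega) (by nlinarith) (by
        rw [← e1, nrm_mul, h, nrm_elt]; norm_num)
    refine ⟨v * elt 3 2, ?_⟩
    rw [mul_pow, ← hv, ← e1, mul_assoc, e2, mul_one]

lemma TotPos.isSquare_of_isUnit {u : O17} (hu : TotPos u) (h : IsUnit u) : ∃ v, u = v ^ 2 := by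
  have hn : nrm u = 1 := by
    have h1 := hu.nrm_pos
    rcases Int.isUnit_iff.1 (isUnit_iff_nrm.1 h) with h2 | h2 <;> omega
  have ht := hu.trc_pos
  obtain ⟨a, b, rfl⟩ := exists_elt u
  rw [trc_elt] at ht
  rcases le_total 0 b with hb | hb
  · exact sq_of_nrm_eq_one_of_nonneg _ a b hb le_rfl ht hn
  · obtain ⟨v, hv⟩ := sq_of_nrm_eq_one_of_nonneg _ (a + b) (-b) (by omega) le_rfl (by linarith)
      (by rw [nrm_elt] at hn ⊢; linarith)
    have h1 : elt a b * v ^ 2 = 1 := by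
      rw [nrm_elt] at hn
      rw [← hv, elt_mul, one_eq_elt]; congr 1 <;> linarith
    exact ⟨elt a b * v, by linear_combination (-elt a b) * h1⟩

lemma exists_isUnit_mul_totPos {x : O17} (hx : x ≠ 0) : ∃ u, IsUnit u ∧ TotPos (u * x) := by
  have key : ∀ {x : O17}, 0 < nrm x → ∃ u, IsUnit u ∧ TotPos (u * x) := by
    intro x hn
    have hn' : (0 : ℝ) < emb1 x * emb2 x := by rw [← nrm_eq_emb]; exact_mod_cast hn
    rcases mul_pos_iff.1 hn' with h | h
    · exact ⟨1, isUnit_one, by simpa [TotPos] using h⟩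
    · exact ⟨-1, isUnit_one.neg, by simpa [TotPos] using h⟩
  rcases lt_trichotomy (nrm x) 0 with h | h | h
  · have he : nrm (elt 3 2) = -1 := by rw [nrm_elt]; norm_num
    obtain ⟨u, hu, hu'⟩ := key (x := elt 3 2 * x) (by rw [nrm_mul, he]; linarith)
    exact ⟨u * elt 3 2, hu.mul (isUnit_iff_nrm.2 (by rw [he]; decide)), by rwa [mul_assoc]⟩
  · exact absurd (nrm_eq_zero.1 h) hx
  · exact key h

lemma exists_totPos_span {I : Ideal O17} (hI : I ≠ 0) :
    ∃ x, TotPos x ∧ I = Ideal.span {x} := by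
  obtain ⟨y, rfl⟩ := IsPrincipalIdealRing.principal I |>.principal
  have hy : y ≠ 0 := by rintro rfl; simp at hI
  obtain ⟨u, hu, hp⟩ := exists_isUnit_mul_totPos hy
  refine ⟨u * y, hp, ?_⟩
  rw [mul_comm, Ideal.span_singleton_mul_right_unit hu]

lemma TotPos.exists_sq_mul {x y : O17} (hx : TotPos x) (hy : TotPos y)
    (h : Associated x y) : ∃ v, IsUnit v ∧ y = x * v ^ 2 := by
  obtain ⟨u, rfl⟩ := h
  obtain ⟨v, hv⟩ := (hy.of_mul hx).isSquare_of_isUnit u.isUnit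
  exact ⟨v, isUnit_pow_iff two_ne_zero |>.1 (hv ▸ u.isUnit), by rw [hv]⟩

/-- Reduction modulo `𝔭₂²`. -/
def red : O17 →+* ZMod 4 := homOfRoot 0 (by decide)

/-- Reduction modulo `𝔭₂'²`. -/
def red' : O17 →+* ZMod 4 := homOfRoot 1 (by decide)

lemma red_elt (a b : ℤ) : red (elt a b) = a := by simp [red, homOfRoot_elt]

lemma red'_elt (a b : ℤ) : red' (elt a b) = a + b := by simp [red', homOfRoot_elt]

lemma chim4_eq (n : ℤ) : chim4 n = ZMod.χ₄ n := by
  rw [ZMod.χ₄_int_eq_if_mod_four, chim4]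
  split_ifs <;> omega

lemma idealChar_span (g : ℤ → ℤ → ℤ) (φ : O17 →* ZMod 4)
    (hg : ∀ a b, ((g a b : ℤ) : ZMod 4) = φ (elt a b)) {x : O17} (hx : TotPos x) :
    idealChar g (Ideal.span {x}) = ZMod.χ₄ (φ x) := by
  have h : ∃ a b : ℤ, Ideal.span {x} = Ideal.span {elt a b} ∧ TotPos (elt a b) := by
    obtain ⟨a, b, rfl⟩ := exists_elt x
    exact ⟨a, b, rfl, hx⟩
  rw [idealChar, dif_pos h, chim4_eq, hg]
  obtain ⟨h1, h2⟩ := h.choose_spec.choose_spec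
  obtain ⟨v, hv, e⟩ := hx.exists_sq_mul h2 (Ideal.span_singleton_eq_span_singleton.1 h1)
  have key : ∀ w : ZMod 4, IsUnit w → w ^ 2 = 1 := by decide
  rw [e, map_mul, map_pow, key _ (hv.map φ), mul_one]

lemma chi_span {x : O17} (hx : TotPos x) :
    chi (Ideal.span {x}) = ZMod.χ₄ (red x) * ZMod.χ₄ (red' x) := by
  rw [← map_mul]
  refine idealChar_span _ ((red : O17 →* ZMod 4) * (red' : O17 →* ZMod 4)) (fun a b => ?_) hx
  have h4 : (4 : ZMod 4) = 0 := rfl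
  simp only [MonoidHom.mul_apply, MonoidHom.coe_coe, red_elt, red'_elt]
  push_cast
  rw [h4]; ring

lemma rho_span {x : O17} (hx : TotPos x) : rho (Ideal.span {x}) = ZMod.χ₄ (red x) :=
  idealChar_span _ (red : O17 →* ZMod 4) (fun a b => by simp [red_elt]) hx

lemma rho'_span {x : O17} (hx : TotPos x) : rho' (Ideal.span {x}) = ZMod.χ₄ (red' x) :=
  idealChar_span _ (red' : O17 →* ZMod 4) (fun a b => by simp [red'_elt]) hx

lemma chi_eq {I : Ideal O17} (hI : I ≠ 0) : chi I = rho I * rho' I := by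
  obtain ⟨x, hx, rfl⟩ := exists_totPos_span hI
  rw [chi_span hx, rho_span hx, rho'_span hx]

lemma rho_mul {I J : Ideal O17} (hI : I ≠ 0) (hJ : J ≠ 0) : rho (I * J) = rho I * rho J := by
  obtain ⟨x, hx, rfl⟩ := exists_totPos_span hI
  obtain ⟨y, hy, rfl⟩ := exists_totPos_span hJ
  rw [Ideal.span_singleton_mul_span_singleton, rho_span hx, rho_span hy, rho_span (hx.mul hy),
    map_mul, map_mul]

lemma rho'_mul {I J : Ideal O17} (hI : I ≠ 0) (hJ : J ≠ 0) :
    rho' (I * J) = rho' I * rho' J := by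
  obtain ⟨x, hx, rfl⟩ := exists_totPos_span hI
  obtain ⟨y, hy, rfl⟩ := exists_totPos_span hJ
  rw [Ideal.span_singleton_mul_span_singleton, rho'_span hx, rho'_span hy, rho'_span (hx.mul hy),
    map_mul, map_mul]

lemma chi_mul {I J : Ideal O17} (hI : I ≠ 0) (hJ : J ≠ 0) : chi (I * J) = chi I * chi J := by
  rw [chi_eq hI, chi_eq hJ, chi_eq (mul_ne_zero hI hJ), rho_mul hI hJ, rho'_mul hI hJ]
  ring

/-- The Dirichlet convolution of two functions on ideals. -/
def dirichletConv (f g : Ideal O17 → ℤ) (I : Ideal O17) : ℤ :=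
  ∑ᶠ p ∈ {p : Ideal O17 × Ideal O17 | p.1 * p.2 = I}, f p.1 * g p.2

lemma finite_dvd {I : Ideal O17} (hI : I ≠ 0) : {J : Ideal O17 | J ∣ I}.Finite := by
  have := UniqueFactorizationMonoid.fintypeSubtypeDvd I hI
  rw [← Set.finite_coe_iff, Set.coe_ofPred]
  infer_instance

lemma finite_pairs {I : Ideal O17} (hI : I ≠ 0) :
    {p : Ideal O17 × Ideal O17 | p.1 * p.2 = I}.Finite :=
  ((finite_dvd hI).prod (finite_dvd hI)).subset fun _ hp =>
    ⟨Dvd.intro _ hp, Dvd.intro_left _ hp⟩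

lemma conv_prime_aux {f g : Ideal O17 → ℤ}
    (hf : ∀ I J, I ≠ 0 → J ≠ 0 → f (I * J) = f I * f J)
    (hg : ∀ I J, I ≠ 0 → J ≠ 0 → g (I * J) = g I * g J)
    {P I : Ideal O17} (hP : Prime P) (hI : I ≠ 0) :
    dirichletConv f g (P * I) +
      ∑ᶠ p ∈ {p : Ideal O17 × Ideal O17 | p.1 * p.2 = P * I ∧ P ∣ p.1 ∧ P ∣ p.2},
      f p.1 * g p.2 = (f P + g P) * dirichletConv f g I := by
  have hPI := mul_ne_zero hP.ne_zero hI
  set s := {p : Ideal O17 × Ideal O17 | p.1 * p.2 = P * I ∧ P ∣ p.1} with hs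
  set t := {p : Ideal O17 × Ideal O17 | p.1 * p.2 = P * I ∧ P ∣ p.2} with ht
  have hsf : s.Finite := (finite_pairs hPI).subset fun p hp => hp.1
  have htf : t.Finite := (finite_pairs hPI).subset fun p hp => hp.1
  have hu : {p : Ideal O17 × Ideal O17 | p.1 * p.2 = P * I} = s ∪ t := by
    ext p
    simp only [hs, ht, Set.mem_union, Set.mem_ofPred_eq, ← and_or_left]
    exact ⟨fun h => ⟨h, hP.dvd_or_dvd (h ▸ dvd_mul_right P I)⟩, fun h => h.1⟩
  have hi : {p : Ideal O17 × Ideal O17 | p.1 * p.2 = P * I ∧ P ∣ p.1 ∧ P ∣ p.2} = s ∩ t := by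
    ext p
    simp only [hs, ht, Set.mem_inter_iff, Set.mem_ofPred_eq]
    tauto
  have hs' : s = (fun p : Ideal O17 × Ideal O17 => (P * p.1, p.2)) '' {p | p.1 * p.2 = I} := by
    ext ⟨A, B⟩
    simp only [hs, Set.mem_ofPred_eq, Set.mem_image, Prod.mk.injEq, Prod.exists]
    constructor
    · rintro ⟨h, C, rfl⟩
      exact ⟨C, B, mul_left_cancel₀ hP.ne_zero (by rw [← h, mul_assoc]), rfl, rfl⟩
    · rintro ⟨C, D, rfl, rfl, rfl⟩
      exact ⟨mul_assoc _ _ _, dvd_mul_right _ _⟩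
  have ht' : t = (fun p : Ideal O17 × Ideal O17 => (p.1, P * p.2)) '' {p | p.1 * p.2 = I} := by
    ext ⟨A, B⟩
    simp only [ht, Set.mem_ofPred_eq, Set.mem_image, Prod.mk.injEq, Prod.exists]
    constructor
    · rintro ⟨h, C, rfl⟩
      exact ⟨A, C, mul_left_cancel₀ hP.ne_zero (by rw [← h, mul_left_comm]), rfl, rfl⟩
    · rintro ⟨C, D, rfl, rfl, rfl⟩
      exact ⟨mul_left_comm _ _ _, dvd_mul_right _ _⟩
  have hne : ∀ p ∈ {p : Ideal O17 × Ideal O17 | p.1 * p.2 = I}, p.1 ≠ 0 ∧ p.2 ≠ 0 := by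
    rintro p rfl
    exact ⟨left_ne_zero_of_mul hI, right_ne_zero_of_mul hI⟩
  rw [dirichletConv, hu, hi, finsum_mem_union_inter hsf htf, hs', ht',
    finsum_mem_image, finsum_mem_image,
    add_mul, dirichletConv, mul_finsum_mem, mul_finsum_mem]
  · congr 1
    · refine finsum_mem_congr rfl fun p hp => ?_
      rw [hf _ _ hP.ne_zero (hne p hp).1, mul_assoc]
    · refine finsum_mem_congr rfl fun p hp => ?_
      rw [hg _ _ hP.ne_zero (hne p hp).2, mul_left_comm]
  · rintro ⟨A, B⟩ - ⟨C, D⟩ - h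
    simp only [Prod.mk.injEq] at h ⊢
    exact ⟨h.1, mul_left_cancel₀ hP.ne_zero h.2⟩
  · rintro ⟨A, B⟩ - ⟨C, D⟩ - h
    simp only [Prod.mk.injEq] at h ⊢
    exact ⟨mul_left_cancel₀ hP.ne_zero h.1, h.2⟩

lemma conv_prime_of_not_dvd {f g : Ideal O17 → ℤ}
    (hf : ∀ I J, I ≠ 0 → J ≠ 0 → f (I * J) = f I * f J)
    (hg : ∀ I J, I ≠ 0 → J ≠ 0 → g (I * J) = g I * g J)
    {P I : Ideal O17} (hP : Prime P) (hI : I ≠ 0) (h : ¬ P ∣ I) :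
    dirichletConv f g (P * I) = (f P + g P) * dirichletConv f g I := by
  rw [← conv_prime_aux hf hg hP hI]
  have : {p : Ideal O17 × Ideal O17 | p.1 * p.2 = P * I ∧ P ∣ p.1 ∧ P ∣ p.2} = ∅ := by
    ext ⟨A, B⟩
    simp only [Set.mem_ofPred_eq, Set.mem_empty_iff_false, iff_false]
    rintro ⟨h1, ⟨C, rfl⟩, ⟨D, rfl⟩⟩
    refine h ⟨C * D, mul_left_cancel₀ hP.ne_zero ?_⟩
    rw [← h1]; ring
  rw [this, finsum_mem_empty, add_zero]

lemma conv_prime_mul_mul {f g : Ideal O17 → ℤ}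
    (hf : ∀ I J, I ≠ 0 → J ≠ 0 → f (I * J) = f I * f J)
    (hg : ∀ I J, I ≠ 0 → J ≠ 0 → g (I * J) = g I * g J)
    {P I : Ideal O17} (hP : Prime P) (hI : I ≠ 0) :
    dirichletConv f g (P * (P * I)) + f P * g P * dirichletConv f g I =
      (f P + g P) * dirichletConv f g (P * I) := by
  rw [← conv_prime_aux hf hg hP (mul_ne_zero hP.ne_zero hI), dirichletConv, dirichletConv,
    mul_finsum_mem]
  congr 1
  have : {p : Ideal O17 × Ideal O17 | p.1 * p.2 = P * (P * I) ∧ P ∣ p.1 ∧ P ∣ p.2} =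
      (fun p : Ideal O17 × Ideal O17 => (P * p.1, P * p.2)) '' {p | p.1 * p.2 = I} := by
    ext ⟨A, B⟩
    simp only [Set.mem_ofPred_eq, Set.mem_image, Prod.mk.injEq, Prod.exists]
    constructor
    · rintro ⟨h1, ⟨C, rfl⟩, ⟨D, rfl⟩⟩
      refine ⟨C, D, mul_left_cancel₀ (mul_ne_zero hP.ne_zero hP.ne_zero) ?_, rfl, rfl⟩
      rw [mul_assoc P P I, ← h1]; ring
    · rintro ⟨C, D, rfl, rfl, rfl⟩
      exact ⟨by ring, dvd_mul_right _ _, dvd_mul_right _ _⟩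
  rw [this, finsum_mem_image]
  · refine finsum_mem_congr rfl ?_
    rintro p rfl
    rw [hf _ _ hP.ne_zero (left_ne_zero_of_mul hI), hg _ _ hP.ne_zero (right_ne_zero_of_mul hI)]
    ring
  · rintro ⟨A, B⟩ - ⟨C, D⟩ - h
    simp only [Prod.mk.injEq] at h ⊢
    exact ⟨mul_left_cancel₀ hP.ne_zero h.1, mul_left_cancel₀ hP.ne_zero h.2⟩

lemma conv_one (f g : Ideal O17 → ℤ) : dirichletConv f g 1 = f 1 * g 1 := by
  have : {p : Ideal O17 × Ideal O17 | p.1 * p.2 = 1} = {(1, 1)} := by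
    ext ⟨A, B⟩
    rw [Set.mem_singleton_iff, Prod.mk.injEq]
    exact mul_eq_one
  rw [dirichletConv, this, finsum_mem_singleton]

lemma sigmaRho_eq_conv (ν : O17) : sigmaRho ν = dirichletConv rho rho' (Ideal.span {ν}) := rfl

lemma sigmaChi_eq_conv {ν : O17} (hν : ν ≠ 0) :
    sigmaChi ν = dirichletConv chi (fun _ => 1) (Ideal.span {ν}) := by
  symm
  refine finsum_mem_eq_of_bijOn Prod.fst ⟨?_, ?_, ?_⟩ (by simp)
  · rintro p hp
    exact Dvd.intro _ hp
  · rintro ⟨A, B⟩ h1 ⟨C, D⟩ h2 (rfl : A = C)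
    simp only [Set.mem_ofPred_eq] at h1 h2
    have hA : A ≠ 0 := by
      rintro rfl
      rw [zero_mul] at h1
      exact hν (by simpa using h1.symm)
    rw [mul_left_cancel₀ hA (h1.trans h2.symm)]
  · rintro A ⟨B, hB⟩
    exact ⟨(A, B), hB.symm, rfl⟩

lemma prime_span {p : O17} (hp : Prime p) : Prime (Ideal.span {p}) := by
  rwa [Ideal.prime_iff_isPrime (by simpa using hp.ne_zero), Ideal.span_singleton_prime hp.ne_zero]

lemma span_mul (x y : O17) : Ideal.span {x * y} = Ideal.span {x} * Ideal.span {y} :=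
  (Ideal.span_singleton_mul_span_singleton x y).symm

lemma span_ne_zero {x : O17} (hx : x ≠ 0) : Ideal.span {x} ≠ 0 := by simpa using hx

lemma span_dvd_span {x y : O17} : Ideal.span {x} ∣ Ideal.span {y} ↔ x ∣ y := by
  rw [Ideal.dvd_span_singleton, Ideal.mem_span_singleton]

lemma sigmaChi_prime_of_not_dvd {p ν : O17} (hp : Prime p) (hp' : TotPos p) (hν : ν ≠ 0)
    (h : ¬ p ∣ ν) :
    sigmaChi (p * ν) = (1 + ZMod.χ₄ (red p) * ZMod.χ₄ (red' p)) * sigmaChi ν := by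
  rw [sigmaChi_eq_conv hν, sigmaChi_eq_conv (mul_ne_zero hp.ne_zero hν), span_mul,
    conv_prime_of_not_dvd (fun _ _ => chi_mul) (by simp) (prime_span hp) (span_ne_zero hν)
      (by rwa [span_dvd_span]), chi_span hp']
  ring

lemma sigmaChi_prime_mul_mul {p ν : O17} (hp : Prime p) (hp' : TotPos p) (hν : ν ≠ 0) :
    sigmaChi (p * (p * ν)) = (1 + ZMod.χ₄ (red p) * ZMod.χ₄ (red' p)) * sigmaChi (p * ν)
      - ZMod.χ₄ (red p) * ZMod.χ₄ (red' p) * sigmaChi ν := by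
  have h := conv_prime_mul_mul (f := chi) (g := fun _ => 1) (fun _ _ => chi_mul) (by simp)
    (prime_span hp) (span_ne_zero hν)
  have hpν := mul_ne_zero hp.ne_zero hν
  rw [sigmaChi_eq_conv hν, sigmaChi_eq_conv hpν, sigmaChi_eq_conv (mul_ne_zero hp.ne_zero hpν),
    span_mul, span_mul]
  rw [chi_span hp'] at h
  linarith

lemma sigmaRho_prime_of_not_dvd {p ν : O17} (hp : Prime p) (hp' : TotPos p) (hν : ν ≠ 0)
    (h : ¬ p ∣ ν) :
    sigmaRho (p * ν) = (ZMod.χ₄ (red p) + ZMod.χ₄ (red' p)) * sigmaRho ν := by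
  rw [sigmaRho_eq_conv, sigmaRho_eq_conv, span_mul,
    conv_prime_of_not_dvd (fun _ _ => rho_mul) (fun _ _ => rho'_mul) (prime_span hp)
      (span_ne_zero hν) (by rwa [span_dvd_span]), rho_span hp', rho'_span hp']

lemma sigmaRho_prime_mul_mul {p ν : O17} (hp : Prime p) (hp' : TotPos p) (hν : ν ≠ 0) :
    sigmaRho (p * (p * ν)) = (ZMod.χ₄ (red p) + ZMod.χ₄ (red' p)) * sigmaRho (p * ν)
      - ZMod.χ₄ (red p) * ZMod.χ₄ (red' p) * sigmaRho ν := by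
  have h := conv_prime_mul_mul (f := rho) (g := rho') (fun _ _ => rho_mul) (fun _ _ => rho'_mul)
    (prime_span hp) (span_ne_zero hν)
  simp only [sigmaRho_eq_conv, span_mul]
  rw [rho_span hp', rho'_span hp'] at h
  linarith

lemma sigmaChi_of_isUnit {u : O17} (hu : IsUnit u) : sigmaChi u = 1 := by
  have h1 : Ideal.span {u} = Ideal.span {1} := by
    rw [Ideal.span_singleton_eq_top.2 hu, Ideal.span_singleton_one]
  rw [sigmaChi_eq_conv hu.ne_zero, h1, Ideal.span_singleton_one, ← Ideal.one_eq_top, conv_one,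
    Ideal.one_eq_top, ← Ideal.span_singleton_one, chi_span totPos_one]
  simp

lemma sigmaRho_of_isUnit {u : O17} (hu : IsUnit u) : sigmaRho u = 1 := by
  have h1 : Ideal.span {u} = Ideal.span {1} := by
    rw [Ideal.span_singleton_eq_top.2 hu, Ideal.span_singleton_one]
  rw [sigmaRho_eq_conv, h1, Ideal.span_singleton_one, ← Ideal.one_eq_top, conv_one,
    Ideal.one_eq_top, ← Ideal.span_singleton_one, rho_span totPos_one, rho'_span totPos_one]
  simp

/-- The representations of `ν` as a sum of two squares. -/
def reps (ν : O17) : Set (O17 × O17) := {t | t.1 ^ 2 + t.2 ^ 2 = ν}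

lemma mem_reps {ν : O17} {t : O17 × O17} : t ∈ reps ν ↔ t.1 ^ 2 + t.2 ^ 2 = ν := Iff.rfl

lemma trc_add (x y : O17) : trc (x + y) = trc x + trc y := by simp [trc]

lemma trc_sq_elt (a b : ℤ) : trc (elt a b ^ 2) = (a + b) ^ 2 + a ^ 2 + 8 * b ^ 2 := by
  rw [elt_sq, trc_elt]; ring

lemma finite_reps (ν : O17) : (reps ν).Finite := by
  set T := trc ν
  have hf : ((Set.Icc (-T) T ×ˢ Set.Icc (-T) T) ×ˢ (Set.Icc (-T) T ×ˢ Set.Icc (-T) T)).Finite :=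
    ((Set.finite_Icc _ _).prod (Set.finite_Icc _ _)).prod
      ((Set.finite_Icc _ _).prod (Set.finite_Icc _ _))
  refine (hf.image fun q : (ℤ × ℤ) × (ℤ × ℤ) =>
    (elt q.1.1 q.1.2, elt q.2.1 q.2.2)).subset ?_
  rintro ⟨x, y⟩ h
  obtain ⟨a, b, rfl⟩ := exists_elt x
  obtain ⟨c, d, rfl⟩ := exists_elt y
  have hT : (a + b) ^ 2 + a ^ 2 + 8 * b ^ 2 + ((c + d) ^ 2 + c ^ 2 + 8 * d ^ 2) = T := by
    rw [← trc_sq_elt, ← trc_sq_elt, ← trc_add]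
    exact congrArg trc h
  have key : ∀ z : ℤ, z ^ 2 ≤ T → z ∈ Set.Icc (-T) T := by
    intro z hz
    have h1 := Int.le_self_sq z
    have h2 := Int.le_self_sq (-z)
    rw [neg_sq] at h2
    exact ⟨by linarith, by linarith⟩
  refine ⟨((a, b), (c, d)), ⟨⟨key a ?_, key b ?_⟩, ⟨key c ?_, key d ?_⟩⟩, rfl⟩ <;>
    linarith [sq_nonneg a, sq_nonneg b, sq_nonneg c, sq_nonneg d, sq_nonneg (a + b),
      sq_nonneg (c + d)]

lemma r2_sq_of_isUnit {v : O17} (hv : IsUnit v) : r2 (v ^ 2) = 4 := by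
  have hv0 := hv.ne_zero
  have hne : v ≠ -v := fun h => hv0 (by
    have : 2 * v = 0 := by linear_combination h
    simpa using this)
  have : reps (v ^ 2) = {(v, 0), (-v, 0), (0, v), (0, -v)} := by
    ext ⟨x, y⟩
    rw [mem_reps]
    simp only [Set.mem_insert_iff, Set.mem_singleton_iff, Prod.mk.injEq]
    constructor
    · intro h
      obtain ⟨x, rfl⟩ := hv.dvd (a := x)
      obtain ⟨y, rfl⟩ := hv.dvd (a := y)
      have h1 : x ^ 2 + y ^ 2 = 1 := mul_left_cancel₀ (pow_ne_zero 2 hv0) (by linear_combination h)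
      obtain ⟨a, b, rfl⟩ := exists_elt x
      obtain ⟨c, d, rfl⟩ := exists_elt y
      have hT : (a + b) ^ 2 + a ^ 2 + 8 * b ^ 2 + ((c + d) ^ 2 + c ^ 2 + 8 * d ^ 2) = 2 := by
        rw [← trc_sq_elt, ← trc_sq_elt, ← trc_add, h1, one_eq_elt, trc_elt]; norm_num
      have hb : b = 0 := by
        rw [← sq_eq_zero_iff]
        linarith [sq_nonneg a, sq_nonneg b, sq_nonneg c, sq_nonneg d, sq_nonneg (a + b),
          sq_nonneg (c + d), show b ^ 2 ≤ 0 by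
            by_contra! hb
            linarith [sq_nonneg a, sq_nonneg c, sq_nonneg d, sq_nonneg (a + b),
              sq_nonneg (c + d)]]
      have hd : d = 0 := by
        rw [← sq_eq_zero_iff]
        linarith [sq_nonneg d, show d ^ 2 ≤ 0 by
            by_contra! hb
            linarith [sq_nonneg a, sq_nonneg c, sq_nonneg b, sq_nonneg (a + b),
              sq_nonneg (c + d)]]
      subst hb hd
      have hac : a ^ 2 + c ^ 2 = 1 := by linarith
      have ha : a ≤ 1 ∧ -1 ≤ a := ⟨by nlinarith, by nlinarith⟩
      have hc : c ≤ 1 ∧ -1 ≤ c := ⟨by nlinarith, by nlinarith⟩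
      obtain ⟨ha1, ha2⟩ := ha
      obtain ⟨hc1, hc2⟩ := hc
      simp only [← intCast_eq_elt]
      interval_cases a <;> interval_cases c <;> simp at hac ⊢
    · rintro (⟨rfl, rfl⟩ | ⟨rfl, rfl⟩ | ⟨rfl, rfl⟩ | ⟨rfl, rfl⟩) <;> ring
  have h0 : r2 (v ^ 2) = (reps (v ^ 2)).ncard := rfl
  rw [h0, this, Set.ncard_insert_of_notMem, Set.ncard_insert_of_notMem,
    Set.ncard_pair] <;> simp [hne, hv0, hv0.symm, neg_eq_zero, eq_comm]

lemma pi2_dvd_iff {x : O17} : pi2 ∣ x ↔ red x = 0 ∨ red x = 2 := by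
  constructor
  · rintro ⟨y, rfl⟩
    rw [map_mul, pi2_eq_elt, red_elt]
    generalize red y = z
    revert z; decide
  · obtain ⟨a, b, rfl⟩ := exists_elt x
    intro h
    rw [red_elt] at h
    have ha : (2 : ℤ) ∣ a := by
      rcases h with h | h
      · have := (ZMod.intCast_zmod_eq_zero_iff_dvd a 4).1 h; omega
      · have := (ZMod.intCast_eq_intCast_iff_dvd_sub a 2 4).1 (by exact_mod_cast h); omega
    obtain ⟨A, rfl⟩ := ha
    refine ⟨pi2' * A + b * (ω - 2), ?_⟩
    simp only [elt]; push_cast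
    have e : pi2 = 2 + ω := rfl
    linear_combination (-A : O17) * pi2_mul_pi2' - b * omega_sq - (b * (ω - 2)) * e

lemma pi2'_dvd_iff {x : O17} : pi2' ∣ x ↔ red' x = 0 ∨ red' x = 2 := by
  constructor
  · rintro ⟨y, rfl⟩
    rw [map_mul, pi2'_eq_elt, red'_elt]
    generalize red' y = z
    revert z; decide
  · obtain ⟨a, b, rfl⟩ := exists_elt x
    intro h
    rw [red'_elt, ← Int.cast_add] at h
    have ha : (2 : ℤ) ∣ a + b := by
      rcases h with h | h
      · have := (ZMod.intCast_zmod_eq_zero_iff_dvd (a + b) 4).1 h; omega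
      · have := (ZMod.intCast_eq_intCast_iff_dvd_sub (a + b) 2 4).1 (by exact_mod_cast h); omega
    obtain ⟨A, hA⟩ := ha
    obtain rfl : a = 2 * A - b := by omega
    refine ⟨pi2 * A + b * (1 + ω), ?_⟩
    simp only [elt]; push_cast
    have e : pi2' = 3 - ω := rfl
    linear_combination (-A : O17) * pi2_mul_pi2' + b * omega_sq - (b * (1 + ω)) * e

/-- `k` divides both `x` and `y` as soon as `k²` divides `x² + y²`. -/
def SqRamified (k : O17) : Prop := ∀ x y : O17, k ^ 2 ∣ x ^ 2 + y ^ 2 → k ∣ x ∧ k ∣ y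

lemma sqRamified_one : SqRamified 1 := fun _ _ _ => ⟨one_dvd _, one_dvd _⟩

lemma sqRamified_pi2 : SqRamified pi2 := by
  rintro x y ⟨z, h⟩
  have h' := congrArg red h
  simp only [map_add, map_pow, map_mul, pi2_dvd_iff] at h' ⊢
  have h2 : red pi2 = 2 := by rw [pi2_eq_elt, red_elt]; rfl
  rw [h2] at h'
  generalize red x = a at *
  generalize red y = b at *
  generalize red z = c at *
  revert a b c; decide

lemma ncard_reps_dvd {k : O17} (hk : k ≠ 0) (ν : O17) :
    {t ∈ reps (k * (k * ν)) | k ∣ t.1 ∧ k ∣ t.2}.ncard = r2 ν := by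
  have : {t ∈ reps (k * (k * ν)) | k ∣ t.1 ∧ k ∣ t.2} =
      (fun t : O17 × O17 => (k * t.1, k * t.2)) '' reps ν := by
    ext ⟨x, y⟩
    simp only [Set.mem_ofPred_eq, mem_reps, Set.mem_image, Prod.mk.injEq, Prod.exists]
    constructor
    · rintro ⟨h, ⟨x, rfl⟩, ⟨y, rfl⟩⟩
      exact ⟨x, y, mul_left_cancel₀ (pow_ne_zero 2 hk) (by linear_combination h), rfl, rfl⟩
    · rintro ⟨x, y, h, rfl, rfl⟩
      exact ⟨by linear_combination k ^ 2 * h, dvd_mul_right _ _, dvd_mul_right _ _⟩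
  rw [this, Set.InjOn.ncard_image]
  · rfl
  · rintro ⟨a, b⟩ - ⟨c, d⟩ - h
    simp only [Prod.mk.injEq] at h ⊢
    exact ⟨mul_left_cancel₀ hk h.1, mul_left_cancel₀ hk h.2⟩

lemma r2_mul_mul {k : O17} (hk : k ≠ 0) (h : SqRamified k) (ν : O17) :
    r2 (k * (k * ν)) = r2 ν := by
  rw [← ncard_reps_dvd hk ν]
  have h0 : r2 (k * (k * ν)) = (reps (k * (k * ν))).ncard := rfl
  rw [h0]
  congr 1
  ext t
  simp only [Set.mem_ofPred_eq, iff_self_and]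
  exact fun ht => h _ _ ⟨ν, by rw [mem_reps.1 ht]; ring⟩

lemma two_dvd_of_two_dvd_sq {x : O17} (h : 2 ∣ x ^ 2) : 2 ∣ x := by
  obtain ⟨a, b, rfl⟩ := exists_elt x
  obtain ⟨y, h⟩ := h
  obtain ⟨c, d, rfl⟩ := exists_elt y
  rw [elt_sq, two_eq_elt, elt_mul] at h
  obtain ⟨h1, h2⟩ := elt_inj h
  have hb : Even b := by
    have : Even (b ^ 2) := ⟨d - a * b, by linarith⟩
    exact (Int.even_pow.1 this).1
  have ha : Even a := by
    have : Even (a ^ 2) := ⟨c - 2 * b ^ 2, by linarith⟩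
    exact (Int.even_pow.1 this).1
  obtain ⟨A, rfl⟩ := ha
  obtain ⟨B, rfl⟩ := hb
  exact ⟨elt A B, by rw [two_eq_elt, elt_mul]; congr 1 <;> ring⟩

lemma r2_two_mul (ν : O17) : r2 (2 * ν) = r2 ν := by
  have h0 : r2 (2 * ν) = (reps (2 * ν)).ncard := rfl
  have : reps (2 * ν) = (fun t : O17 × O17 => (t.1 + t.2, t.1 - t.2)) '' reps ν := by
    ext ⟨x, y⟩
    simp only [mem_reps, Set.mem_image, Prod.mk.injEq, Prod.exists]
    constructor
    · intro h
      obtain ⟨z, hz⟩ : 2 ∣ x + y := two_dvd_of_two_dvd_sq ⟨ν + x * y, by linear_combination h⟩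
      refine ⟨z, x - z, mul_left_cancel₀ (two_ne_zero (α := O17)) ?_, by ring,
        by linear_combination -hz⟩
      linear_combination h - hz * (2 * z - x + y)
    · rintro ⟨x, y, h, rfl, rfl⟩
      linear_combination 2 * h
  rw [h0, this, Set.InjOn.ncard_image]
  · rfl
  · rintro ⟨a, b⟩ - ⟨c, d⟩ - h
    simp only [Prod.mk.injEq] at h ⊢
    constructor <;> refine mul_left_cancel₀ (two_ne_zero (α := O17)) ?_
    · linear_combination h.1 + h.2
    · linear_combination h.1 - h.2

lemma r2_pi2'_mul (ν : O17) : r2 (pi2' * ν) = r2 (pi2 * ν) := by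
  rw [← r2_two_mul (pi2 * ν), ← pi2_mul_pi2', ← r2_mul_mul totPos_pi2.ne_zero sqRamified_pi2]
  congr 1; ring

lemma ncard_reps_split {p k x₀ y₀ : O17} (hp : Prime p) (hk : k ≠ 0) (hkr : SqRamified k)
    (h₀ : x₀ ^ 2 + y₀ ^ 2 = k * p) (ν : O17) :
    {t ∈ reps (p * ν) | p ∣ t.1 * y₀ + t.2 * x₀}.ncard = r2 (k * ν) := by
  have h1 : (fun t : O17 × O17 => (t.1 * x₀ - t.2 * y₀, t.1 * y₀ + t.2 * x₀)) ''
      {t ∈ reps (p * ν) | p ∣ t.1 * y₀ + t.2 * x₀} =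
      (fun t : O17 × O17 => (p * t.1, p * t.2)) '' reps (k * ν) := by
    ext ⟨u, w⟩
    simp only [Set.mem_ofPred_eq, mem_reps, Set.mem_image, Prod.mk.injEq, Prod.exists]
    constructor
    · rintro ⟨x, y, ⟨h, ⟨Y, hY⟩⟩, rfl, rfl⟩
      have hX : p ∣ x * x₀ - y * y₀ := by
        refine hp.dvd_of_dvd_pow (n := 2) ⟨p * k * ν - p * Y ^ 2, ?_⟩
        linear_combination h * (x₀ ^ 2 + y₀ ^ 2) + p * ν * h₀ - (x * y₀ + y * x₀ + p * Y) * hY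
      obtain ⟨X, hX⟩ := hX
      refine ⟨X, Y, mul_left_cancel₀ (pow_ne_zero 2 hp.ne_zero) ?_, hX.symm, hY.symm⟩
      linear_combination h * (x₀ ^ 2 + y₀ ^ 2) + p * ν * h₀ - (x * y₀ + y * x₀ + p * Y) * hY
        - (x * x₀ - y * y₀ + p * X) * hX
    · rintro ⟨X, Y, h, rfl, rfl⟩
      obtain ⟨⟨x, hx⟩, ⟨y, hy⟩⟩ := hkr (X * x₀ + Y * y₀) (Y * x₀ - X * y₀)
        ⟨ν * p, by linear_combination h * (x₀ ^ 2 + y₀ ^ 2) + k * ν * h₀⟩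
      have e1 : x * x₀ - y * y₀ = p * X := mul_left_cancel₀ hk (by
        linear_combination -x₀ * hx + y₀ * hy + X * h₀)
      have e2 : x * y₀ + y * x₀ = p * Y := mul_left_cancel₀ hk (by
        linear_combination -y₀ * hx - x₀ * hy + Y * h₀)
      refine ⟨x, y, ⟨mul_left_cancel₀ (pow_ne_zero 2 hk) ?_, ⟨Y, e2⟩⟩, e1, e2⟩
      linear_combination h * (x₀ ^ 2 + y₀ ^ 2) + k * ν * h₀ - (X * x₀ + Y * y₀ + k * x) * hx
        - (Y * x₀ - X * y₀ + k * y) * hy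
  have h2 := congrArg Set.ncard h1
  rw [Set.InjOn.ncard_image, Set.InjOn.ncard_image] at h2
  · exact h2
  · rintro ⟨a, b⟩ - ⟨c, d⟩ - h
    simp only [Prod.mk.injEq] at h ⊢
    exact ⟨mul_left_cancel₀ hp.ne_zero h.1, mul_left_cancel₀ hp.ne_zero h.2⟩
  · rintro ⟨a, b⟩ - ⟨c, d⟩ - h
    simp only [Prod.mk.injEq] at h ⊢
    have hkp := mul_ne_zero hk hp.ne_zero
    constructor <;> refine mul_left_cancel₀ hkp ?_
    · linear_combination x₀ * h.1 + y₀ * h.2 - (a - c) * h₀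
    · linear_combination x₀ * h.2 - y₀ * h.1 - (b - d) * h₀

lemma r2_split_aux {p k x₀ y₀ : O17} (hp : Prime p) (hp2 : ¬ p ∣ 2) (hk : k ≠ 0)
    (hkr : SqRamified k) (hpk : ¬ p ∣ k) (h₀ : x₀ ^ 2 + y₀ ^ 2 = k * p) (ν : O17) :
    r2 (p * ν) + {t ∈ reps (p * ν) | p ∣ t.1 ∧ p ∣ t.2}.ncard = 2 * r2 (k * ν) := by
  have hx₀ : ¬ p ∣ x₀ ∧ ¬ p ∣ y₀ := by
    have key : ∀ {x y : O17}, x ^ 2 + y ^ 2 = k * p → ¬ p ∣ x := by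
      rintro x y h ⟨X, rfl⟩
      obtain ⟨Y, rfl⟩ : p ∣ y := hp.dvd_of_dvd_pow (n := 2)
        ⟨k - p * X ^ 2, by linear_combination h⟩
      exact hpk ⟨X ^ 2 + Y ^ 2, mul_left_cancel₀ hp.ne_zero (by linear_combination -h)⟩
    exact ⟨key h₀, key (by rw [add_comm]; exact h₀)⟩
  set s := {t ∈ reps (p * ν) | p ∣ t.1 * y₀ + t.2 * x₀} with hs
  set s' := {t ∈ reps (p * ν) | p ∣ t.1 * (-y₀) + t.2 * x₀} with hs'
  have h1 : s.ncard = r2 (k * ν) := ncard_reps_split hp hk hkr h₀ ν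
  have h2 : s'.ncard = r2 (k * ν) := ncard_reps_split hp hk hkr (by rw [neg_sq, h₀]) ν
  have hu : s ∪ s' = reps (p * ν) := by
    ext ⟨x, y⟩
    simp only [hs, hs', Set.mem_union, Set.mem_ofPred_eq, ← and_or_left, and_iff_left_iff_imp]
    intro h
    rw [mem_reps] at h
    refine hp.dvd_or_dvd ⟨k * y ^ 2 - ν * y₀ ^ 2, ?_⟩
    linear_combination y ^ 2 * h₀ - y₀ ^ 2 * h
  have hi : s ∩ s' = {t ∈ reps (p * ν) | p ∣ t.1 ∧ p ∣ t.2} := by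
    ext ⟨x, y⟩
    simp only [hs, hs', Set.mem_inter_iff, Set.mem_ofPred_eq, ← and_and_left, and_congr_right_iff]
    intro _
    constructor
    · rintro ⟨ha, hb⟩
      have h3 : p ∣ 2 * (y * x₀) := by convert dvd_add ha hb using 1; ring
      have h4 : p ∣ 2 * (x * y₀) := by convert dvd_sub ha hb using 1; ring
      exact ⟨((hp.dvd_or_dvd ((hp.dvd_or_dvd h4).resolve_left hp2)).resolve_right hx₀.2),
        ((hp.dvd_or_dvd ((hp.dvd_or_dvd h3).resolve_left hp2)).resolve_right hx₀.1)⟩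
    · rintro ⟨ha, hb⟩
      exact ⟨dvd_add (ha.mul_right _) (hb.mul_right _), dvd_add (ha.mul_right _) (hb.mul_right _)⟩
  have h5 := Set.ncard_union_add_ncard_inter s s' ((finite_reps _).subset fun t ht => ht.1)
    ((finite_reps _).subset fun t ht => ht.1)
  rw [hu, hi, h1, h2] at h5
  rw [two_mul, ← h5]; rfl

lemma reps_dvd_eq_empty {p ν : O17} (hp : p ≠ 0) (h : ¬ p ∣ ν) :
    {t ∈ reps (p * ν) | p ∣ t.1 ∧ p ∣ t.2} = ∅ := by
  ext ⟨x, y⟩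
  simp only [Set.mem_ofPred_eq, Set.mem_empty_iff_false, iff_false, mem_reps]
  rintro ⟨h1, ⟨X, rfl⟩, ⟨Y, rfl⟩⟩
  exact h ⟨X ^ 2 + Y ^ 2, mul_left_cancel₀ hp (by linear_combination -h1)⟩

lemma r2_split_of_not_dvd {p k x₀ y₀ : O17} (hp : Prime p) (hp2 : ¬ p ∣ 2) (hk : k ≠ 0)
    (hkr : SqRamified k) (hpk : ¬ p ∣ k) (h₀ : x₀ ^ 2 + y₀ ^ 2 = k * p) {ν : O17}
    (h : ¬ p ∣ ν) : r2 (p * ν) = 2 * r2 (k * ν) := by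
  rw [← r2_split_aux hp hp2 hk hkr hpk h₀, reps_dvd_eq_empty hp.ne_zero h, Set.ncard_empty,
    add_zero]

lemma r2_split_mul_mul {p k x₀ y₀ : O17} (hp : Prime p) (hp2 : ¬ p ∣ 2) (hk : k ≠ 0)
    (hkr : SqRamified k) (hpk : ¬ p ∣ k) (h₀ : x₀ ^ 2 + y₀ ^ 2 = k * p) (ν : O17) :
    r2 (p * (p * ν)) + r2 ν = 2 * r2 (k * (p * ν)) := by
  rw [← r2_split_aux hp hp2 hk hkr hpk h₀, ncard_reps_dvd hp.ne_zero]

/-- A binary Hermitian form over `ℤ[i]` of determinant 17, positive definite, takes a value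
between 1 and 5. -/
lemma exists_hermitian_le (n : ℕ) : ∀ A C B₁ B₂ : ℤ, 0 < A → A ≤ n →
    A * C - B₁ ^ 2 - B₂ ^ 2 = 17 → ∃ S₁ S₂ T₁ T₂ : ℤ,
      0 < A * (S₁ ^ 2 + S₂ ^ 2) + 2 * (B₁ * (S₁ * T₁ + S₂ * T₂) - B₂ * (S₂ * T₁ - S₁ * T₂))
        + C * (T₁ ^ 2 + T₂ ^ 2) ∧
      A * (S₁ ^ 2 + S₂ ^ 2) + 2 * (B₁ * (S₁ * T₁ + S₂ * T₂) - B₂ * (S₂ * T₁ - S₁ * T₂))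
        + C * (T₁ ^ 2 + T₂ ^ 2) ≤ 5 := by
  induction n with
  | zero => intro A C B₁ B₂ h1 h2; exact absurd h1 (by simpa using h2)
  | succ n ih =>
    intro A C B₁ B₂ hA hn h
    by_cases h5 : A ≤ 5
    · exact ⟨1, 0, 0, 0, by linarith, by linarith⟩
    have key : ∀ B : ℤ, ∃ k : ℤ, 4 * (B - A * k) ^ 2 ≤ A ^ 2 := by
      intro B
      refine ⟨(2 * B + A) / (2 * A), ?_⟩
      have h1 := Int.mul_ediv_add_emod (2 * B + A) (2 * A)
      have h2 := Int.emod_nonneg (2 * B + A) (show 2 * A ≠ 0 by omega)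
      have h3 := Int.emod_lt_of_pos (2 * B + A) (show 0 < 2 * A by omega)
      set k := (2 * B + A) / (2 * A)
      set r := (2 * B + A) % (2 * A)
      have h4 : 2 * (B - A * k) = r - A := by linarith
      have : (r - A) ^ 2 ≤ A ^ 2 := by nlinarith
      calc 4 * (B - A * k) ^ 2 = (2 * (B - A * k)) ^ 2 := by ring
        _ ≤ A ^ 2 := by rw [h4]; exact this
    obtain ⟨k₁, hk₁⟩ := key B₁
    obtain ⟨k₂, hk₂⟩ := key B₂
    set C' := C - 2 * (B₁ * k₁ + B₂ * k₂) + A * (k₁ ^ 2 + k₂ ^ 2) with hC'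
    have hdet : A * C' = 17 + (B₁ - A * k₁) ^ 2 + (B₂ - A * k₂) ^ 2 := by
      rw [hC']; linear_combination h
    have hC0 : 0 < C' := by
      have : 0 < A * C' := by rw [hdet]; positivity
      exact pos_of_mul_pos_right this hA.le
    have hCA : C' < A := by
      by_contra! hc
      nlinarith
    obtain ⟨T₁, T₂, S₁, S₂, h1, h2⟩ := ih C' A (B₁ - A * k₁) (-(B₂ - A * k₂)) hC0
      (by push_cast at hn; omega) (by linear_combination hdet)
    refine ⟨S₁ - (k₁ * T₁ + k₂ * T₂), S₂ - (k₁ * T₂ - k₂ * T₁), T₁, T₂, ?_, ?_⟩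
    · convert h1 using 1; rw [hC']; ring
    · convert h2 using 1; rw [hC']; ring

lemma trc_mul_intCast (n : ℤ) (x : O17) : trc (n * x) = n * trc x := by
  obtain ⟨a, b, rfl⟩ := exists_elt x
  rw [intCast_eq_elt, elt_mul, trc_elt, trc_elt]; ring

lemma exists_mul_eq_of_hermitian {p s t g₁ g₂ m₁ m₃ β₁ β₂ : O17} (hp : TotPos p)
    (h₁ : s ^ 2 + t ^ 2 = p * m₁) (h₃ : g₁ ^ 2 + g₂ ^ 2 = p * m₃)
    (hβ₁ : s * g₁ + t * g₂ = p * β₁) (hβ₂ : t * g₁ - s * g₂ = p * β₂)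
    (hpos : 0 < trc m₁)
    (h : trc m₁ * trc m₃ - trc β₁ ^ 2 - trc β₂ ^ 2 = 17) :
    ∃ m x y, TotPos m ∧ trc m ≤ 5 ∧ x ^ 2 + y ^ 2 = m * p := by
  obtain ⟨S₁, S₂, T₁, T₂, h0, h5⟩ := exists_hermitian_le (trc m₁).toNat (trc m₁) (trc m₃)
    (trc β₁) (trc β₂) hpos (by omega) h
  set m : O17 := ((S₁ ^ 2 + S₂ ^ 2 : ℤ) : O17) * m₁ + ((2 * (S₁ * T₁ + S₂ * T₂) : ℤ) : O17) * β₁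
    + ((-2 * (S₂ * T₁ - S₁ * T₂) : ℤ) : O17) * β₂ + ((T₁ ^ 2 + T₂ ^ 2 : ℤ) : O17) * m₃ with hm
  have htr : trc m = trc m₁ * (S₁ ^ 2 + S₂ ^ 2) + 2 * (trc β₁ * (S₁ * T₁ + S₂ * T₂)
      - trc β₂ * (S₂ * T₁ - S₁ * T₂)) + trc m₃ * (T₁ ^ 2 + T₂ ^ 2) := by
    rw [hm, trc_add, trc_add, trc_add, trc_mul_intCast, trc_mul_intCast, trc_mul_intCast,
      trc_mul_intCast]
    ring
  rw [← htr] at h0 h5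
  have hxy : (S₁ * s - S₂ * t + T₁ * g₁ - T₂ * g₂) ^ 2 +
      (S₁ * t + S₂ * s + T₁ * g₂ + T₂ * g₁) ^ 2 = m * p := by
    rw [hm]; push_cast
    linear_combination ((S₁ : O17) ^ 2 + S₂ ^ 2) * h₁ + (2 * (S₁ * T₁ + S₂ * T₂) : O17) * hβ₁
      - (2 * (S₂ * T₁ - S₁ * T₂) : O17) * hβ₂ + ((T₁ : O17) ^ 2 + T₂ ^ 2) * h₃
  refine ⟨m, _, _, ?_, h5, hxy⟩
  have hm0 : m ≠ 0 := by
    intro hm0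
    rw [hm0, zero_eq_elt, trc_elt] at h0
    simp at h0
  refine TotPos.of_mul (x := p) ?_ hp
  rw [mul_comm, ← hxy]
  apply totPos_sq_add_sq
  by_contra! hc
  rw [hc.1, hc.2] at hxy
  exact mul_ne_zero hm0 hp.ne_zero (by linear_combination -hxy)

lemma eq_of_trc_le_five {m : O17} (hm : TotPos m) (h : trc m ≤ 5) :
    m = 1 ∨ m = 2 ∨ m = pi2 ∨ m = pi2' := by
  have h0 := hm.trc_pos
  have h1 := hm.nrm_pos
  obtain ⟨a, b, rfl⟩ := exists_elt m
  rw [trc_elt] at h h0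
  rw [nrm_elt] at h1
  have hb : b ≤ 1 ∧ -1 ≤ b := ⟨by nlinarith, by nlinarith⟩
  obtain ⟨hb1, hb2⟩ := hb
  have ha : a ≤ 3 := by linarith
  have ha' : 0 ≤ a := by linarith
  rw [one_eq_elt, two_eq_elt, pi2_eq_elt, pi2'_eq_elt]
  interval_cases b <;> interval_cases a <;> simp at h h0 h1 ⊢

lemma sqRamified_pi2' : SqRamified pi2' := by
  rintro x y ⟨z, h⟩
  have h' := congrArg red' h
  simp only [map_add, map_pow, map_mul, pi2'_dvd_iff] at h' ⊢
  have h2 : red' pi2' = 2 := by rw [pi2'_eq_elt, red'_elt]; rfl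
  rw [h2] at h'
  generalize red' x = a at *
  generalize red' y = b at *
  generalize red' z = c at *
  revert a b c; decide

/-- `ν` or `π₂ν` is a sum of two squares. -/
def IsRep (ν : O17) : Prop := ∃ x y : O17, x ^ 2 + y ^ 2 = ν ∨ x ^ 2 + y ^ 2 = pi2 * ν

lemma isRep_of_mul {p m x y : O17} (hm : TotPos m) (h5 : trc m ≤ 5)
    (h : x ^ 2 + y ^ 2 = m * p) : IsRep p := by
  rcases eq_of_trc_le_five hm h5 with rfl | rfl | rfl | rfl
  · exact ⟨x, y, Or.inl (by rw [h, one_mul])⟩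
  · obtain ⟨z, hz⟩ : 2 ∣ x + y := two_dvd_of_two_dvd_sq ⟨p + x * y, by linear_combination h⟩
    refine ⟨z, x - z, Or.inl (mul_left_cancel₀ (two_ne_zero (α := O17)) ?_)⟩
    linear_combination h - hz * (2 * z - x + y)
  · exact ⟨x, y, Or.inr h⟩
  · obtain ⟨⟨u, hu⟩, ⟨w, hw⟩⟩ := sqRamified_pi2' (x + y) (x - y)
      ⟨pi2 * p, by linear_combination 2 * h - pi2' * p * pi2_mul_pi2'⟩
    refine ⟨u, w, Or.inr (mul_left_cancel₀ (pow_ne_zero 2 totPos_pi2'.ne_zero) ?_)⟩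
    linear_combination 2 * h - pi2' * p * pi2_mul_pi2' - (x + y + pi2' * u) * hu
      - (x - y + pi2' * w) * hw

lemma isRep_of_nrm {p : O17} (hp : TotPos p) {q : ℕ} (hq : q.Prime) (hq1 : q % 4 = 1)
    (h : nrm p = q) : IsRep p := by
  have := Fact.mk hq
  obtain ⟨s, t, hst⟩ := Nat.Prime.sq_add_sq (p := q) (by omega)
  have htr := hp.trc_pos
  obtain ⟨a, b, rfl⟩ := exists_elt p
  rw [nrm_elt] at h
  rw [trc_elt] at htr
  have hco : IsCoprime a b := by
    rw [← isRelPrime_iff_isCoprime]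
    intro d ⟨a', ha⟩ ⟨b', hb⟩
    have hd : d * d ∣ (q : ℤ) := ⟨a' ^ 2 + a' * b' - 4 * b' ^ 2, by rw [← h, ha, hb]; ring⟩
    exact (Nat.prime_iff_prime_int.1 hq).irreducible.squarefree d hd
  obtain ⟨u, v, huv⟩ := hco
  have hst' : (s : ℤ) ^ 2 + t ^ 2 = q := by exact_mod_cast hst
  obtain ⟨m, x, y, hm, h5, hxy⟩ := exists_mul_eq_of_hermitian (p := elt a b)
    (s := ((s : ℤ) : O17)) (t := ((t : ℤ) : O17)) (g₁ := elt a b * elt (v - u) u) (g₂ := 0)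
    (m₁ := elt (a + b) (-b)) (m₃ := elt a b * elt (v - u) u ^ 2)
    (β₁ := ((s : ℤ) : O17) * elt (v - u) u) (β₂ := ((t : ℤ) : O17) * elt (v - u) u) hp
    (by
      rw [elt_mul, ← Int.cast_pow, ← Int.cast_pow, ← Int.cast_add, hst', intCast_eq_elt, ← h]
      congr 1 <;> ring)
    (by ring) (by ring) (by ring) (by rw [trc_elt]; linarith)
    (by
      rw [trc_mul_intCast, trc_mul_intCast, elt_sq, elt_mul, trc_elt, trc_elt, trc_elt]
      linear_combination (-(2 * (v - u) + u) ^ 2) * (hst'.trans h.symm)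
        + 17 * (u * a + v * b + 1) * huv)
  exact isRep_of_mul hm h5 hxy

lemma exists_dvd_sq_add (q : ℕ) (hq : q.Prime) (hq3 : q % 4 = 3) (hqp : Prime (q : O17)) :
    ∃ w₁ w₂ k : ℤ, 1 - 2 * w₁ = q ∧ 4 + w₁ ^ 2 + w₂ ^ 2 = q * k := by
  have := Fact.mk hq
  have h2 : (2 : ZMod q) ≠ 0 := by
    intro h
    have : q ∣ 2 := (ZMod.natCast_eq_zero_iff 2 q).1 (by exact_mod_cast h)
    have := Nat.le_of_dvd (by norm_num) this
    interval_cases q <;> omega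
  have h17 : ¬ IsSquare (17 : ZMod q) := by
    rintro ⟨r, hr⟩
    obtain ⟨w, hw⟩ := ZMod.intCast_surjective ((1 + r) / 2)
    have h1 : ((w ^ 2 - w - 4 : ℤ) : ZMod q) = 0 := by
      push_cast
      rw [hw]; field_simp
      linear_combination -hr
    obtain ⟨k, hk⟩ := (ZMod.intCast_zmod_eq_zero_iff_dvd _ q).1 h1
    have hk' : (w : O17) ^ 2 - w - 4 = q * k := by exact_mod_cast congrArg (Int.cast : ℤ → O17) hk
    have hd : (q : O17) ∣ (w - ω) * (w + ω - 1) := ⟨k, by linear_combination hk' - omega_sq⟩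
    have hunit : ∀ a b : ℤ, IsUnit b → ¬ (q : O17) ∣ elt a b := by
      rintro a b hb ⟨z, hz⟩
      obtain ⟨c, d, rfl⟩ := exists_elt z
      rw [show (q : O17) = elt q 0 by rw [← intCast_eq_elt]; simp, elt_mul] at hz
      obtain ⟨-, h⟩ := elt_inj hz
      have : (q : ℤ) ∣ b := ⟨d, by rw [h]; ring⟩
      exact (Nat.prime_iff_prime_int.1 hq).not_isUnit (isUnit_of_dvd_unit this hb)
    rcases hqp.dvd_or_dvd hd with h | h
    · exact hunit w (-1) (by decide) (by convert h using 1; simp [elt]; ring)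
    · exact hunit (w - 1) 1 isUnit_one (by convert h using 1; simp [elt]; ring)
  have hm1 : ¬ IsSquare (-1 : ZMod q) := by
    rw [ZMod.exists_sq_eq_neg_one_iff]; omega
  have hm17 : IsSquare (-17 : ZMod q) := by
    rw [← quadraticChar_one_iff_isSquare]
    · rw [show (-17 : ZMod q) = -1 * 17 by ring, map_mul,
        quadraticChar_neg_one_iff_not_isSquare.2 h17, quadraticChar_neg_one_iff_not_isSquare.2 hm1]
      norm_num
    · rw [neg_ne_zero]
      intro h; exact h17 (h ▸ IsSquare.zero)
  obtain ⟨r, hr⟩ := hm17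
  obtain ⟨w₂, hw₂⟩ := ZMod.intCast_surjective (r / 2)
  obtain ⟨w₁, hw₁⟩ : ∃ w₁ : ℤ, 1 - 2 * w₁ = q := ⟨(1 - q) / 2, by omega⟩
  have hw₁' : (w₁ : ZMod q) = 1 / 2 := by
    have := congrArg (Int.cast : ℤ → ZMod q) hw₁
    push_cast at this
    rw [ZMod.natCast_self] at this
    field_simp
    linear_combination -this
  have h1 : ((4 + w₁ ^ 2 + w₂ ^ 2 : ℤ) : ZMod q) = 0 := by
    push_cast
    rw [hw₂, hw₁']; field_simp
    linear_combination -hr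
  obtain ⟨k, hk⟩ := (ZMod.intCast_zmod_eq_zero_iff_dvd _ q).1 h1
  exact ⟨w₁, w₂, k, hw₁, hk⟩

lemma isRep_natCast {q : ℕ} (hq : q.Prime) (hq2 : q % 2 = 1) (hqp : Prime (q : O17)) :
    IsRep q := by
  rcases (show q % 4 = 1 ∨ q % 4 = 3 by omega) with h1 | h3
  · have := Fact.mk hq
    obtain ⟨s, t, hst⟩ := Nat.Prime.sq_add_sq (p := q) (by omega)
    exact ⟨s, t, Or.inl (by exact_mod_cast hst)⟩
  · obtain ⟨w₁, w₂, k, hw, hk⟩ := exists_dvd_sq_add q hq h3 hqp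
    have hq0 : 0 < q := hq.pos
    have hw' : (1 - 2 * w₁ : O17) = q := by exact_mod_cast congrArg (Int.cast : ℤ → O17) hw
    have hk' : (4 + w₁ ^ 2 + w₂ ^ 2 : O17) = q * k := by
      exact_mod_cast congrArg (Int.cast : ℤ → O17) hk
    have hω : ∀ n : ℤ, ω + n = elt n 1 := fun n => by simp [elt, add_comm]
    have hqe : (q : O17) = elt q 0 := by rw [← intCast_eq_elt]; simp
    obtain ⟨m, x, y, hm, h5, hxy⟩ := exists_mul_eq_of_hermitian (p := (q : O17))
      (s := q) (t := 0) (g₁ := ω - w₁) (g₂ := -w₂) (m₁ := q) (m₃ := ω + k) (β₁ := ω - w₁)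
      (β₂ := w₂) (by simp [TotPos, hq0]) (by ring)
      (by linear_combination omega_sq + ω * hw' + hk') (by ring) (by ring)
      (by rw [hqe, trc_elt]; omega)
      (by
        rw [hω, show ω - w₁ = elt (-w₁) 1 by rw [← hω]; push_cast; ring, intCast_eq_elt, hqe,
          trc_elt, trc_elt, trc_elt, trc_elt]
        linear_combination (-4 : ℤ) * hk - 2 * hw)
    exact isRep_of_mul hm h5 hxy

lemma prime_classification {p : O17} (hp : Prime p) (hpos : TotPos p) (hp2 : ¬ p ∣ 2) :
    ∃ q : ℕ, q.Prime ∧ q % 2 = 1 ∧ (nrm p = q ∨ ∃ v, IsUnit v ∧ (q : O17) = p * v ^ 2) := by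
  obtain ⟨q, hq, hpq⟩ : ∃ q : ℕ, q.Prime ∧ p ∣ (q : O17) := by
    have h0 := hpos.nrm_pos
    obtain ⟨p', hp'⟩ := exists_conj p
    have h1 : p ∣ (((nrm p).toNat.primeFactorsList.map (Nat.cast : ℕ → O17)).prod) := by
      rw [← Nat.cast_list_prod, Nat.prod_primeFactorsList (by omega)]
      refine ⟨p', ?_⟩
      rw [hp', ← Int.cast_natCast, Int.toNat_of_nonneg h0.le]
    obtain ⟨a, ha, hpa⟩ := hp.dvd_prod_iff.1 h1
    obtain ⟨q, hq, rfl⟩ := List.mem_map.1 ha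
    exact ⟨q, Nat.prime_of_mem_primeFactorsList hq, hpa⟩
  refine ⟨q, hq, ?_, ?_⟩
  · rcases hq.eq_two_or_odd with rfl | h
    · exact absurd (by exact_mod_cast hpq) hp2
    · exact h
  · obtain ⟨r, hr⟩ := hpq
    have hn : nrm p * nrm r = (q : ℤ) ^ 2 := by
      rw [← nrm_mul, ← hr, ← Int.cast_natCast, nrm_intCast]
    have h0 := hpos.nrm_pos
    obtain ⟨n, hnn⟩ := Int.eq_ofNat_of_zero_le h0.le
    have hd : n ∣ q ^ 2 := by
      rw [← Int.natCast_dvd_natCast, ← hnn]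
      exact ⟨nrm r, by push_cast; exact hn.symm⟩
    obtain ⟨i, hi, rfl⟩ := (Nat.dvd_prime_pow hq).1 hd
    interval_cases i
    · exact absurd (isUnit_iff_nrm.2 (by rw [hnn]; simp)) hp.not_isUnit
    · exact Or.inl (by simpa using hnn)
    · right
      have hr1 : nrm r = 1 := by
        have : ((q : ℤ) ^ 2) ≠ 0 := pow_ne_zero 2 (by exact_mod_cast hq.ne_zero)
        apply mul_left_cancel₀ this
        rw [mul_one]
        simpa [hnn] using hn
      have hu : IsUnit r := isUnit_iff_nrm.2 (by rw [hr1]; exact isUnit_one)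
      refine hpos.exists_sq_mul (by simp [TotPos, hq.pos]) ⟨hu.unit, ?_⟩
      rw [hr]; rfl

lemma nrm_red (x : O17) : (nrm x : ZMod 4) = red x * red' x := by
  obtain ⟨a, b, rfl⟩ := exists_elt x
  have h4 : (4 : ZMod 4) = 0 := rfl
  rw [nrm_elt, red_elt, red'_elt]
  push_cast
  rw [h4]; ring

lemma isRep_of_split {p : O17} (hp : Prime p) (hpos : TotPos p) (hp2 : ¬ p ∣ 2)
    (h : ZMod.χ₄ (red p) * ZMod.χ₄ (red' p) = 1) : IsRep p := by
  obtain ⟨q, hq, hq2, hn | ⟨v, hv, hqv⟩⟩ := prime_classification hp hpos hp2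
  · refine isRep_of_nrm hpos hq ?_ hn
    rw [← map_mul, ← nrm_red, hn, Int.cast_natCast, ZMod.χ₄_nat_eq_if_mod_four] at h
    split_ifs at h <;> omega
  · have hqp : Prime (q : O17) := by
      rw [hqv]
      exact (Associated.prime_iff ⟨(hv.pow 2).unit, rfl⟩).1 hp
    obtain ⟨w, hw⟩ := hv.exists_right_inv
    obtain ⟨x, y, hxy⟩ := isRep_natCast hq hq2 hqp
    have hw2 : v ^ 2 * w ^ 2 = 1 := by rw [← mul_pow, hw, one_pow]
    rw [hqv] at hxy
    refine ⟨x * w, y * w, hxy.imp (fun e => ?_) fun e => ?_⟩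
    · linear_combination w ^ 2 * e + p * hw2
    · linear_combination w ^ 2 * e + pi2 * p * hw2

lemma dvd_of_dvd_sq_add_sq {p : O17} (hp : Prime p) (hpos : TotPos p) (hp2 : ¬ p ∣ 2)
    (h : ZMod.χ₄ (red p) * ZMod.χ₄ (red' p) = -1) {x y : O17} (hxy : p ∣ x ^ 2 + y ^ 2) :
    p ∣ x ∧ p ∣ y := by
  obtain ⟨q, hq, hq2, hn | ⟨v, hv, hqv⟩⟩ := prime_classification hp hpos hp2
  · have := Fact.mk hq
    have hq3 : q % 4 = 3 := by
      rw [← map_mul, ← nrm_red, hn, Int.cast_natCast, ZMod.χ₄_nat_eq_if_mod_four] at h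
      split_ifs at h; omega
    have hqI := Nat.prime_iff_prime_int.1 hq
    obtain ⟨p', hp'⟩ := exists_conj p
    rw [hn] at hp'
    have hint : ∀ m : ℤ, p ∣ (m : O17) ↔ (q : ℤ) ∣ m := by
      intro m
      constructor
      · rintro ⟨z, hz⟩
        have := congrArg nrm hz
        rw [nrm_mul, nrm_intCast, hn] at this
        exact hqI.dvd_of_dvd_pow ⟨_, this⟩
      · rintro ⟨z, rfl⟩
        exact ⟨p' * z, by push_cast; rw [← mul_assoc, hp', Int.cast_natCast]⟩
    have hcong : ∀ x : O17, ∃ m : ℤ, p ∣ x - m := by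
      obtain ⟨a, b, rfl⟩ := exists_elt p
      have hb : ¬ (q : ℤ) ∣ b := by
        rintro ⟨b', rfl⟩
        rw [nrm_elt] at hn
        obtain ⟨a', rfl⟩ : (q : ℤ) ∣ a :=
          hqI.dvd_of_dvd_pow (n := 2) ⟨1 - a * b' + 4 * q * b' ^ 2, by linear_combination hn⟩
        refine hqI.irreducible.not_isUnit (hqI.irreducible.squarefree q
          ⟨a' ^ 2 + a' * b' - 4 * b' ^ 2, by linear_combination -hn⟩)
      obtain ⟨u, v, huv⟩ := (hqI.coprime_iff_not_dvd).2 hb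
      intro x
      obtain ⟨c, d, rfl⟩ := exists_elt x
      refine ⟨c - d * v * a, p' * (u * d * ω) + d * v, ?_⟩
      have huv' : (u * q + v * b : O17) = 1 := by
        exact_mod_cast congrArg (Int.cast : ℤ → O17) huv
      have e : elt a b = a + b * ω := rfl
      have e' : elt c d = c + d * ω := rfl
      rw [e']
      push_cast at hp' ⊢
      linear_combination (-(u * d * ω : O17)) * hp' - (d * v : O17) * e - d * ω * huv'
    obtain ⟨m, hm⟩ := hcong x
    obtain ⟨n, hnn⟩ := hcong y
    have h1 : p ∣ ((m ^ 2 + n ^ 2 : ℤ) : O17) := by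
      have := dvd_sub (dvd_sub hxy (hm.mul_left (x + m))) (hnn.mul_left (y + n))
      convert this using 1
      push_cast; ring
    rw [hint] at h1
    have h2 := (ZMod.intCast_zmod_eq_zero_iff_dvd _ q).2 h1
    push_cast at h2
    have key : ∀ s t : ZMod q, s ^ 2 + t ^ 2 = 0 → t = 0 := by
      intro s t hst
      by_contra ht
      exact ZMod.mod_four_ne_three_of_sq_eq_neg_sq' ht (eq_neg_of_add_eq_zero_left hst) hq3
    have h3 := (hint m).2 ((ZMod.intCast_zmod_eq_zero_iff_dvd _ q).1
      (key n m (by rw [add_comm]; exact h2)))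
    have h4 := (hint n).2 ((ZMod.intCast_zmod_eq_zero_iff_dvd _ q).1 (key m n h2))
    exact ⟨(dvd_sub_left h3).1 hm, (dvd_sub_left h4).1 hnn⟩
  · exfalso
    have h1 : nrm (q : O17) = q ^ 2 := by rw [← Int.cast_natCast, nrm_intCast]
    have hv1 : red v ^ 2 = 1 ∧ red' v ^ 2 = 1 := by
      have key : ∀ w : ZMod 4, IsUnit w → w ^ 2 = 1 := by decide
      exact ⟨key _ (hv.map red), key _ (hv.map red')⟩
    have h2 := nrm_red (q : O17)
    rw [h1, hqv, map_mul, map_mul, map_pow, map_pow, hv1.1, hv1.2, mul_one, mul_one] at h2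
    rw [← map_mul, ← h2] at h
    push_cast at h
    generalize (q : ZMod 4) = z at h
    revert z; decide

lemma red_pi2 : red pi2 = 2 := by rw [pi2_eq_elt, red_elt]; rfl

lemma red'_pi2 : red' pi2 = 3 := by rw [pi2_eq_elt, red'_elt]; rfl

lemma red_pi2' : red pi2' = 3 := by rw [pi2'_eq_elt, red_elt]; rfl

lemma red'_pi2' : red' pi2' = 2 := by rw [pi2'_eq_elt, red'_elt]; rfl

lemma irreducible_of_nrm_eq_two {x : O17} (h : nrm x = 2) : Irreducible x := by
  refine ⟨fun hu => ?_, fun a b hab => ?_⟩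
  · rw [isUnit_iff_nrm, h] at hu
    exact absurd hu (by decide)
  · rw [isUnit_iff_nrm, isUnit_iff_nrm]
    rw [hab, nrm_mul] at h
    exact (Int.prime_two.irreducible).isUnit_or_isUnit h.symm

lemma prime_pi2 : Prime pi2 :=
  (irreducible_of_nrm_eq_two (by rw [pi2_eq_elt, nrm_elt]; norm_num)).prime

lemma prime_pi2' : Prime pi2' :=
  (irreducible_of_nrm_eq_two (by rw [pi2'_eq_elt, nrm_elt]; norm_num)).prime

lemma sigmaChi_ramified_mul {p ν : O17} (hp : Prime p) (hp' : TotPos p) (hν : ν ≠ 0)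
    (h : ZMod.χ₄ (red p) * ZMod.χ₄ (red' p) = 0) : sigmaChi (p * ν) = sigmaChi ν := by
  by_cases hd : p ∣ ν
  · obtain ⟨ν, rfl⟩ := hd
    rw [sigmaChi_prime_mul_mul hp hp' (right_ne_zero_of_mul hν), h]; ring
  · rw [sigmaChi_prime_of_not_dvd hp hp' hν hd, h]; ring

lemma sigmaRho_ramified_mul {p ν : O17} (hp : Prime p) (hp' : TotPos p) (hν : ν ≠ 0)
    (h : ZMod.χ₄ (red p) * ZMod.χ₄ (red' p) = 0) :
    sigmaRho (p * ν) = (ZMod.χ₄ (red p) + ZMod.χ₄ (red' p)) * sigmaRho ν := by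
  by_cases hd : p ∣ ν
  · obtain ⟨ν, rfl⟩ := hd
    rw [sigmaRho_prime_mul_mul hp hp' (right_ne_zero_of_mul hν), h]; ring
  · rw [sigmaRho_prime_of_not_dvd hp hp' hν hd]

/-- The two squares formula for `ν` and for `π₂ν`. -/
def TwoSquares (ν : O17) : Prop :=
  (r2 ν : ℤ) = 2 * sigmaChi ν + 2 * sigmaRho ν ∧
    (r2 (pi2 * ν) : ℤ) = 2 * sigmaChi ν - 2 * sigmaRho ν

lemma twoSquares_of_isUnit {u : O17} (hu : IsUnit u) (hpos : TotPos u) : TwoSquares u := by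
  rw [TwoSquares, sigmaChi_of_isUnit hu, sigmaRho_of_isUnit hu]
  obtain ⟨v, rfl⟩ := hpos.isSquare_of_isUnit hu
  rw [isUnit_pow_iff two_ne_zero] at hu
  refine ⟨by rw [r2_sq_of_isUnit hu]; norm_num, ?_⟩
  have h0 : r2 (pi2 * v ^ 2) = (reps (pi2 * v ^ 2)).ncard := rfl
  have : reps (pi2 * v ^ 2) = ∅ := by
    ext ⟨x, y⟩
    rw [mem_reps]
    simp only [Set.mem_empty_iff_false, iff_false]
    intro h
    have h' := congrArg red' h
    simp only [map_add, map_mul, map_pow, red'_pi2] at h'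
    have hw := hu.map red'
    generalize red' v = w at *
    generalize red' x = a at *
    generalize red' y = b at *
    revert w a b; decide
  rw [h0, this]; simp

lemma TwoSquares.pi2_mul {ν : O17} (hν : ν ≠ 0) (h : TwoSquares ν) : TwoSquares (pi2 * ν) := by
  have hc : ZMod.χ₄ (red pi2) = 0 := by rw [red_pi2]; rfl
  have hc' : ZMod.χ₄ (red' pi2) = -1 := by rw [red'_pi2]; rfl
  rw [TwoSquares, r2_mul_mul totPos_pi2.ne_zero sqRamified_pi2,
    sigmaChi_ramified_mul prime_pi2 totPos_pi2 hν (by rw [hc, zero_mul]),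
    sigmaRho_ramified_mul prime_pi2 totPos_pi2 hν (by rw [hc, zero_mul]), hc, hc', h.1, h.2]
  constructor <;> ring

lemma TwoSquares.pi2'_mul {ν : O17} (hν : ν ≠ 0) (h : TwoSquares ν) : TwoSquares (pi2' * ν) := by
  have hc : ZMod.χ₄ (red pi2') = -1 := by rw [red_pi2']; rfl
  have hc' : ZMod.χ₄ (red' pi2') = 0 := by rw [red'_pi2']; rfl
  rw [TwoSquares, r2_pi2'_mul, ← mul_assoc, pi2_mul_pi2', r2_two_mul,
    sigmaChi_ramified_mul prime_pi2' totPos_pi2' hν (by rw [hc', mul_zero]),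
    sigmaRho_ramified_mul prime_pi2' totPos_pi2' hν (by rw [hc', mul_zero]), hc, hc', h.1, h.2]
  constructor <;> ring

section Prime

variable {p ν : O17}

lemma r2_eq_zero_of_inert (hp : p ≠ 0)
    (hdvd : ∀ {x y : O17}, p ∣ x ^ 2 + y ^ 2 → p ∣ x ∧ p ∣ y) (h : ¬ p ∣ ν) :
    r2 (p * ν) = 0 := by
  have h0 : r2 (p * ν) = (reps (p * ν)).ncard := rfl
  rw [h0, ← Set.ncard_empty (O17 × O17), ← reps_dvd_eq_empty hp h]
  congr 1
  ext t
  simp only [Set.mem_ofPred_eq, iff_self_and]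
  exact fun ht => hdvd ⟨ν, mem_reps.1 ht⟩

lemma twoSquares_inert_of_not_dvd (hp : Prime p) (hpos : TotPos p) (hp2 : ¬ p ∣ 2)
    (hc : ZMod.χ₄ (red p) * ZMod.χ₄ (red' p) = -1) (hc' : ZMod.χ₄ (red p) + ZMod.χ₄ (red' p) = 0)
    (hν : ν ≠ 0) (h : ¬ p ∣ ν) : TwoSquares (p * ν) := by
  have hpν : ¬ p ∣ pi2 * ν := by
    rw [hp.dvd_mul, not_or]
    exact ⟨fun h => hp2 (h.trans ⟨_, pi2_mul_pi2'.symm⟩), h⟩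
  rw [TwoSquares, mul_left_comm, r2_eq_zero_of_inert hp.ne_zero
    (dvd_of_dvd_sq_add_sq hp hpos hp2 hc) h, r2_eq_zero_of_inert hp.ne_zero
    (dvd_of_dvd_sq_add_sq hp hpos hp2 hc) hpν, sigmaChi_prime_of_not_dvd hp hpos hν h,
    sigmaRho_prime_of_not_dvd hp hpos hν h, hc, hc']
  simp

lemma TwoSquares.inert_mul_mul (hp : Prime p) (hpos : TotPos p) (hp2 : ¬ p ∣ 2)
    (hc : ZMod.χ₄ (red p) * ZMod.χ₄ (red' p) = -1) (hc' : ZMod.χ₄ (red p) + ZMod.χ₄ (red' p) = 0)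
    (hν : ν ≠ 0) (h : TwoSquares ν) : TwoSquares (p * (p * ν)) := by
  have hr : SqRamified p := fun x y hxy =>
    dvd_of_dvd_sq_add_sq hp hpos hp2 hc ((dvd_pow_self p two_ne_zero).trans hxy)
  rw [TwoSquares, mul_left_comm pi2, mul_left_comm pi2, r2_mul_mul hp.ne_zero hr,
    r2_mul_mul hp.ne_zero hr, sigmaChi_prime_mul_mul hp hpos hν,
    sigmaRho_prime_mul_mul hp hpos hν, hc, hc', h.1, h.2]
  constructor <;> ring

lemma split_cases (hp : Prime p) (hpos : TotPos p) (hp2 : ¬ p ∣ 2)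
    (hc : ZMod.χ₄ (red p) * ZMod.χ₄ (red' p) = 1) :
    (ZMod.χ₄ (red p) = 1 ∧ ZMod.χ₄ (red' p) = 1 ∧ ∃ x y, x ^ 2 + y ^ 2 = 1 * p) ∨
    (ZMod.χ₄ (red p) = -1 ∧ ZMod.χ₄ (red' p) = -1 ∧ ∃ x y, x ^ 2 + y ^ 2 = pi2 * p) := by
  obtain ⟨x, y, h | h⟩ := isRep_of_split hp hpos hp2 hc
  · have key : ZMod.χ₄ (red' p) = 1 := by
      rw [← h] at hc ⊢
      simp only [map_add, map_pow] at hc ⊢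
      have : ∀ a b : ZMod 4, ZMod.χ₄ (a ^ 2 + b ^ 2) = 0 ∨ ZMod.χ₄ (a ^ 2 + b ^ 2) = 1 := by
        decide
      refine (this _ _).resolve_left fun h0 => ?_
      rw [h0, mul_zero] at hc
      exact absurd hc (by norm_num)
    rw [key, mul_one] at hc
    exact Or.inl ⟨hc, key, x, y, by rw [h, one_mul]⟩
  · have key : ZMod.χ₄ (red' p) = -1 := by
      have h' := congrArg red' h
      simp only [map_add, map_pow, map_mul, red'_pi2] at h'
      generalize red' p = b at *
      have : ∀ a c b : ZMod 4, a ^ 2 + c ^ 2 = 3 * b → ZMod.χ₄ b = 0 ∨ ZMod.χ₄ b = -1 := by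
        decide
      refine (this _ _ _ h').resolve_left fun h0 => ?_
      rw [h0, mul_zero] at hc
      exact absurd hc (by norm_num)
    rw [key] at hc
    exact Or.inr ⟨by linarith, key, x, y, h⟩

lemma TwoSquares.split_mul (hp : Prime p) (hpos : TotPos p) (hp2 : ¬ p ∣ 2)
    (hc : ZMod.χ₄ (red p) * ZMod.χ₄ (red' p) = 1) (hν : ν ≠ 0) (hd : ¬ p ∣ ν)
    (h : TwoSquares ν) : TwoSquares (p * ν) := by
  have hpi : ¬ p ∣ pi2 := fun h => hp2 (h.trans ⟨_, pi2_mul_pi2'.symm⟩)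
  have hpν : ¬ p ∣ pi2 * ν := by rw [hp.dvd_mul, not_or]; exact ⟨hpi, hd⟩
  rw [TwoSquares, mul_left_comm, sigmaChi_prime_of_not_dvd hp hpos hν hd,
    sigmaRho_prime_of_not_dvd hp hpos hν hd]
  rcases split_cases hp hpos hp2 hc with ⟨e, e', x, y, hxy⟩ | ⟨e, e', x, y, hxy⟩
  · have hp1 : ¬ p ∣ 1 := hp.not_dvd_one
    rw [r2_split_of_not_dvd hp hp2 one_ne_zero sqRamified_one hp1 hxy hd,
      r2_split_of_not_dvd hp hp2 one_ne_zero sqRamified_one hp1 hxy hpν, one_mul, one_mul, e, e']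
    push_cast
    rw [h.1, h.2]
    constructor <;> ring
  · rw [r2_split_of_not_dvd hp hp2 prime_pi2.ne_zero sqRamified_pi2 hpi hxy hd,
      r2_split_of_not_dvd hp hp2 prime_pi2.ne_zero sqRamified_pi2 hpi hxy hpν,
      r2_mul_mul prime_pi2.ne_zero sqRamified_pi2, e, e']
    push_cast
    rw [h.1, h.2]
    constructor <;> ring

lemma TwoSquares.split_mul_mul (hp : Prime p) (hpos : TotPos p) (hp2 : ¬ p ∣ 2)
    (hc : ZMod.χ₄ (red p) * ZMod.χ₄ (red' p) = 1) (hν : ν ≠ 0) (h : TwoSquares ν)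
    (hpν : TwoSquares (p * ν)) : TwoSquares (p * (p * ν)) := by
  have hpi : ¬ p ∣ pi2 := fun h => hp2 (h.trans ⟨_, pi2_mul_pi2'.symm⟩)
  rw [TwoSquares, mul_left_comm pi2, mul_left_comm pi2, sigmaChi_prime_mul_mul hp hpos hν,
    sigmaRho_prime_mul_mul hp hpos hν]
  obtain ⟨h1, h2⟩ := h
  obtain ⟨h3, h4⟩ := hpν
  rcases split_cases hp hpos hp2 hc with ⟨e, e', x, y, hxy⟩ | ⟨e, e', x, y, hxy⟩
  · have hp1 : ¬ p ∣ 1 := hp.not_dvd_one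
    have h5 := r2_split_mul_mul hp hp2 one_ne_zero sqRamified_one hp1 hxy ν
    have h6 := r2_split_mul_mul hp hp2 one_ne_zero sqRamified_one hp1 hxy (pi2 * ν)
    rw [one_mul] at h5 h6
    rw [mul_left_comm] at h4
    zify at h5 h6
    rw [e, e']
    constructor <;> linarith
  · have h5 := r2_split_mul_mul hp hp2 prime_pi2.ne_zero sqRamified_pi2 hpi hxy ν
    have h6 := r2_split_mul_mul hp hp2 prime_pi2.ne_zero sqRamified_pi2 hpi hxy (pi2 * ν)
    rw [mul_left_comm p pi2 ν, r2_mul_mul prime_pi2.ne_zero sqRamified_pi2] at h6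
    rw [mul_left_comm p pi2 ν]
    zify at h5 h6
    rw [e, e']
    constructor <;> linarith

end Prime

lemma exists_prime_totPos_dvd {ν : O17} (hν : ν ≠ 0) (hu : ¬ IsUnit ν) :
    ∃ p, Prime p ∧ TotPos p ∧ p ∣ ν := by
  obtain ⟨p, hp, hpν⟩ := WfDvdMonoid.exists_irreducible_factor hu hν
  obtain ⟨u, hu, hpos⟩ := exists_isUnit_mul_totPos hp.ne_zero
  have ha : Associated p (u * p) := ⟨hu.unit, mul_comm _ _⟩
  exact ⟨u * p, ha.prime_iff.1 hp.prime, hpos, ha.dvd_iff_dvd_left.1 hpν⟩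

lemma nrm_lt_nrm_mul {p ν : O17} (hp : Prime p) (hpos : TotPos p) (hν : TotPos ν) :
    (nrm ν).toNat < (nrm (p * ν)).toNat := by
  have h1 := hpos.nrm_pos
  have h2 := hν.nrm_pos
  have h3 : nrm p ≠ 1 := fun h => hp.not_isUnit (isUnit_iff_nrm.2 (by rw [h]; exact isUnit_one))
  have h4 : 2 ≤ nrm p := by omega
  rw [nrm_mul]
  have : nrm ν < nrm p * nrm ν := by nlinarith
  omega

lemma twoSquares_of_totPos (n : ℕ) : ∀ ν : O17, (nrm ν).toNat < n → TotPos ν → TwoSquares ν := by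
  induction n with
  | zero => intro ν h; exact absurd h (Nat.not_lt_zero _)
  | succ n ih =>
    intro ν hn hν
    have step : ∀ {p μ : O17}, Prime p → TotPos p → TotPos (p * μ) →
        (nrm (p * μ)).toNat < n + 1 → TotPos μ ∧ (nrm μ).toNat < n ∧ TwoSquares μ := by
      intro p μ hp hpos hpμ hlt
      have hμ := hpμ.of_mul hpos
      have := nrm_lt_nrm_mul hp hpos hμ
      exact ⟨hμ, by omega, ih _ (by omega) hμ⟩
    by_cases hu : IsUnit ν
    · exact twoSquares_of_isUnit hu hν
    by_cases h2 : pi2 ∣ ν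
    · obtain ⟨μ, rfl⟩ := h2
      obtain ⟨hμ, -, h⟩ := step prime_pi2 totPos_pi2 hν hn
      exact h.pi2_mul hμ.ne_zero
    by_cases h2' : pi2' ∣ ν
    · obtain ⟨μ, rfl⟩ := h2'
      obtain ⟨hμ, -, h⟩ := step prime_pi2' totPos_pi2' hν hn
      exact h.pi2'_mul hμ.ne_zero
    obtain ⟨p, hp, hpos, μ, rfl⟩ := exists_prime_totPos_dvd hν.ne_zero hu
    have hp2 : ¬ p ∣ 2 := by
      rw [← pi2_mul_pi2', hp.dvd_mul, not_or]
      exact ⟨fun h => h2 ((hp.associated_of_dvd prime_pi2 h).symm.dvd.mul_right μ),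
        fun h => h2' ((hp.associated_of_dvd prime_pi2' h).symm.dvd.mul_right μ)⟩
    have hr := mt (fun h => (pi2_dvd_iff.2 h).mul_right μ) h2
    have hr' := mt (fun h => (pi2'_dvd_iff.2 h).mul_right μ) h2'
    obtain ⟨hμ, hlt, h⟩ := step hp hpos hν hn
    have hcc : (ZMod.χ₄ (red p) * ZMod.χ₄ (red' p) = 1) ∨
        (ZMod.χ₄ (red p) * ZMod.χ₄ (red' p) = -1 ∧
          ZMod.χ₄ (red p) + ZMod.χ₄ (red' p) = 0) := by
      generalize red p = a at *
      generalize red' p = b at *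
      revert a b; decide
    by_cases hd : p ∣ μ
    · obtain ⟨κ, rfl⟩ := hd
      obtain ⟨hκ, -, h'⟩ := step hp hpos hμ (by omega)
      rcases hcc with hc | ⟨hc, hc'⟩
      · exact TwoSquares.split_mul_mul hp hpos hp2 hc hκ.ne_zero h' h
      · exact TwoSquares.inert_mul_mul hp hpos hp2 hc hc' hκ.ne_zero h'
    · rcases hcc with hc | ⟨hc, hc'⟩
      · exact TwoSquares.split_mul hp hpos hp2 hc hμ.ne_zero hd h
      · exact twoSquares_inert_of_not_dvd hp hpos hp2 hc hc' hμ.ne_zero hd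

/-- For every totally positive ν ∈ O_K,
r_{2,K}(ν) = 2·σ_{0,χ}(ν) + 2·σ_{0,ρ₂}^{ρ₂'}(ν). -/
theorem two_squares_formula17 (ν : O17) (hpos : TotPos ν) :
    (r2 ν : ℤ) = 2 * sigmaChi ν + 2 * sigmaRho ν := by
  exact (twoSquares_of_totPos _ ν (Nat.lt_succ_self _) hpos).1

end Paper17
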